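/- Let (M,g) be a smooth compact Riemannian 3-manifold with boundary, diffeomorphic to the closed unit ball in ℝ³, satisfying Ric = 0 on M and whose boundary second fundamental form Θ satisfies tr Θ = 2 and trace-free part Θ̂ = 0. Then (M,g) is isometric to the closed unit ball (B̄(0,1), e) in Euclidean 3-space. -/

import Mathlib

open scoped BigOperators

namespace Stmt12

/-- The ambient space `ℝ³` (the manifold `M ≅ B̄(0,1)` in global coordinates). -/
abbrev V3 := EuclideanSpace ℝ (Fin 3)

/-- Partial derivative in coordinate direction `i`. -/
noncomputable def pd (i : Fin 3) (f : V3 → ℝ) : V3 → ℝ :=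
  fun x => fderiv ℝ f x (EuclideanSpace.single i 1)

/-- Christoffel symbols `Γ^l_{ij}` of the metric `g`. -/
noncomputable def Γc (g ginv : V3 → Fin 3 → Fin 3 → ℝ) (l i j : Fin 3) : V3 → ℝ :=
  fun x => (1/2) * ∑ m, ginv x l m *
    (pd i (fun y => g y m j) x + pd j (fun y => g y m i) x - pd m (fun y => g y i j) x)

/-- Riemann curvature `R^l{}_{abc}`. -/
noncomputable def Riem (g ginv : V3 → Fin 3 → Fin 3 → ℝ) (l a b c : Fin 3) : V3 → ℝ :=
  fun x => pd b (Γc g ginv l a c) x - pd c (Γc g ginv l a b) x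
    + ∑ m, (Γc g ginv l b m x * Γc g ginv m a c x - Γc g ginv l c m x * Γc g ginv m a b x)

/-- Ricci curvature `Ric_{ab} = R^c{}_{acb}`. -/
noncomputable def Ricci (g ginv : V3 → Fin 3 → Fin 3 → ℝ) (a b : Fin 3) : V3 → ℝ :=
  fun x => ∑ c, Riem g ginv c a c b x

end Stmt12

section ParallelSections

open Set Filter Topology MeasureTheory
open scoped ContDiff unitInterval

universe u

/-- Evaluating a continuous family of linear maps at a vector. -/
noncomputable def ContinuousMap.evalFamilyL (T E W : Type*) [TopologicalSpace T] [CompactSpace T]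
    [NormedAddCommGroup E] [NormedSpace ℝ E] [NormedAddCommGroup W] [NormedSpace ℝ W] :
    C(T, E →L[ℝ] W) →L[ℝ] E →L[ℝ] C(T, W) :=
  LinearMap.mkContinuous₂
    (LinearMap.mk₂ ℝ
      (fun (G : C(T, E →L[ℝ] W)) (e : E) => (⟨fun t => G t e, by fun_prop⟩ : C(T, W)))
      (fun _ _ _ => by ext; simp) (fun _ _ _ => by ext; simp)
      (fun _ _ _ => by ext; simp) (fun _ _ _ => by ext; simp)) 1
    (fun G e => by
      rw [ContinuousMap.norm_le _ (by positivity)]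
      intro t
      simpa using (G t).le_of_opNorm_le (G.norm_coe_le_norm t) e)

@[simp]
lemma ContinuousMap.evalFamilyL_apply {T E W : Type*} [TopologicalSpace T] [CompactSpace T]
    [NormedAddCommGroup E] [NormedSpace ℝ E] [NormedAddCommGroup W] [NormedSpace ℝ W]
    (G : C(T, E →L[ℝ] W)) (e : E) (t : T) : evalFamilyL T E W G e t = G t e := rfl

/-- Applying a continuous family of linear maps to a continuous family of vectors. -/
noncomputable def ContinuousMap.applyFamilyL (T E W : Type*) [TopologicalSpace T] [CompactSpace T]
    [NormedAddCommGroup E] [NormedSpace ℝ E] [NormedAddCommGroup W] [NormedSpace ℝ W] :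
    C(T, E →L[ℝ] W) →L[ℝ] C(T, E) →L[ℝ] C(T, W) :=
  LinearMap.mkContinuous₂
    (LinearMap.mk₂ ℝ
      (fun (G : C(T, E →L[ℝ] W)) (e : C(T, E)) => (⟨fun t => G t (e t), by fun_prop⟩ : C(T, W)))
      (fun _ _ _ => by ext; simp) (fun _ _ _ => by ext; simp)
      (fun _ _ _ => by ext; simp) (fun _ _ _ => by ext; simp)) 1
    (fun G e => by
      rw [ContinuousMap.norm_le _ (by positivity)]
      intro t
      simpa using (G t).le_of_opNorm_le_of_le (G.norm_coe_le_norm t) (e.norm_coe_le_norm t))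

@[simp]
lemma ContinuousMap.applyFamilyL_apply {T E W : Type*} [TopologicalSpace T] [CompactSpace T]
    [NormedAddCommGroup E] [NormedSpace ℝ E] [NormedAddCommGroup W] [NormedSpace ℝ W]
    (G : C(T, E →L[ℝ] W)) (e : C(T, E)) (t : T) : applyFamilyL T E W G e t = G t (e t) := rfl

/-- The family of paths on the unit interval given by a jointly continuous map. -/
def pathFamily {E W : Type*} [TopologicalSpace E] [TopologicalSpace W] (a : E × ℝ → W)
    (ha : Continuous a) (x : E) : C(I, W) :=
  ⟨fun t => a (x, t), by fun_prop⟩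

@[simp]
lemma pathFamily_apply {E W : Type*} [TopologicalSpace E] [TopologicalSpace W] (a : E × ℝ → W)
    (ha : Continuous a) (x : E) (t : I) : pathFamily a ha x t = a (x, t) := rfl

lemma continuous_pathFamily {E W : Type*} [TopologicalSpace E] [TopologicalSpace W] (a : E × ℝ → W)
    (ha : Continuous a) : Continuous (pathFamily a ha) :=
  ContinuousMap.continuous_of_continuous_uncurry _ (by
    change Continuous fun p : E × I => a (p.1, (p.2 : ℝ))
    fun_prop)

lemma hasFDerivAt_pathFamily {E W : Type*} [NormedAddCommGroup E] [NormedSpace ℝ E]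
    [NormedAddCommGroup W] [NormedSpace ℝ W] {a : E × ℝ → W} (ha : Continuous a)
    {a' : E × ℝ → E →L[ℝ] W} (ha' : Continuous a')
    (h : ∀ x t, HasFDerivAt (fun y => a (y, t)) (a' (x, t)) x) (x : E) :
    HasFDerivAt (pathFamily a ha)
      (ContinuousMap.evalFamilyL I E W (pathFamily a' ha' x)) x := by
  rw [hasFDerivAt_iff_isLittleO, Asymptotics.isLittleO_iff]
  intro ε hε
  have hnear := Metric.tendstoUniformly_iff.1 (ContinuousMap.tendsto_iff_tendstoUniformly.1
    ((continuous_pathFamily a' ha').tendsto x)) ε hε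
  obtain ⟨δ, hδ, hball⟩ := Metric.mem_nhds_iff.1 hnear
  filter_upwards [Metric.ball_mem_nhds x hδ] with y hy
  rw [ContinuousMap.norm_le _ (by positivity)]
  intro t
  refine (convex_ball x δ).norm_image_sub_le_of_norm_hasFDerivWithin_le'
    (f := fun y => a (y, (t : ℝ))) (φ := a' (x, t)) (f' := fun y => a' (y, t))
    (fun z _ => (h z t).hasFDerivWithinAt) (fun z hz => ?_) (Metric.mem_ball_self hδ) hy
  have h1 := hball hz t
  rw [dist_comm, dist_eq_norm] at h1
  exact h1.le

lemma contDiff_nat_pathFamily {E : Type u} [NormedAddCommGroup E] [NormedSpace ℝ E] (n : ℕ) :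
    ∀ {W : Type u} [NormedAddCommGroup W] [NormedSpace ℝ W] {a : E × ℝ → W}
      (_ : ContDiff ℝ n a) (hc : Continuous a), ContDiff ℝ n (pathFamily a hc) := by
  induction n with
  | zero =>
    intro W _ _ a _ hc
    exact contDiff_zero.2 (continuous_pathFamily a hc)
  | succ n ih =>
    intro W _ _ a ha hc
    have hd : Differentiable ℝ a := ha.differentiable (by simp)
    have hf : ContDiff ℝ n (fderiv ℝ a) := ha.fderiv_right (by simp)
    have hg : ContDiff ℝ n
        (fun p : E × ℝ => (fderiv ℝ a p).comp (ContinuousLinearMap.inl ℝ E ℝ)) := by fun_prop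
    have key := hasFDerivAt_pathFamily hc hg.continuous (fun x t => by
      have h1 : HasFDerivAt (fun y : E => (y, t)) (ContinuousLinearMap.inl ℝ E ℝ) x :=
        hasFDerivAt_prodMk_left x t
      exact (hd (x, t)).hasFDerivAt.comp x h1)
    rw [Nat.cast_succ, contDiff_succ_iff_hasFDerivAt]
    exact ⟨fun x => ContinuousMap.evalFamilyL I E W (pathFamily _ hg.continuous x),
      contDiff_const.clm_apply (ih hg hg.continuous), key⟩

lemma contDiff_pathFamily {E W : Type u} [NormedAddCommGroup E] [NormedSpace ℝ E]
    [NormedAddCommGroup W] [NormedSpace ℝ W] {a : E × ℝ → W} (ha : ContDiff ℝ ∞ a) :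
    ContDiff ℝ ∞ (pathFamily a ha.continuous) :=
  contDiff_infty.2 fun n => contDiff_nat_pathFamily n (ha.of_le (by exact_mod_cast le_top)) _

/-- A continuous function on the unit interval, extended to be constant outside. -/
noncomputable def ContinuousMap.extendI {W : Type*} [TopologicalSpace W] (f : C(I, W))
    (s : ℝ) : W :=
  f (projIcc 0 1 zero_le_one s)

lemma ContinuousMap.continuous_extendI {W : Type*} [TopologicalSpace W] (f : C(I, W)) :
    Continuous f.extendI := f.continuous.comp continuous_projIcc

lemma ContinuousMap.extendI_of_mem {W : Type*} [TopologicalSpace W] (f : C(I, W)) {s : ℝ}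
    (hs : s ∈ Icc (0 : ℝ) 1) : f.extendI s = f ⟨s, hs⟩ := by
  rw [extendI, projIcc_of_mem]

section
variable {W : Type*} [NormedAddCommGroup W] [NormedSpace ℝ W]

/-- The primitive vanishing at `0` of a continuous function on the unit interval. -/
noncomputable def volterra (W : Type*) [NormedAddCommGroup W] [NormedSpace ℝ W] :
    C(I, W) →L[ℝ] C(I, W) :=
  LinearMap.mkContinuous
    { toFun := fun f => ⟨fun t => ∫ s in (0 : ℝ)..t, f.extendI s,
        (intervalIntegral.continuous_primitive
          (fun _ _ => f.continuous_extendI.intervalIntegrable _ _) 0).comp continuous_subtype_val⟩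
      map_add' := fun f g => by
        ext t
        exact intervalIntegral.integral_add (f.continuous_extendI.intervalIntegrable _ _)
          (g.continuous_extendI.intervalIntegrable _ _)
      map_smul' := fun c f => by
        ext t
        exact intervalIntegral.integral_smul c f.extendI } 1
    (fun f => by
      rw [ContinuousMap.norm_le _ (by positivity)]
      intro t
      refine (intervalIntegral.norm_integral_le_of_norm_le_const
        (fun s _ => f.norm_coe_le_norm _)).trans ?_
      have h0 := t.2.1
      have h1 := t.2.2
      rw [sub_zero, abs_of_nonneg h0]
      nlinarith [norm_nonneg f])

lemma volterra_apply (f : C(I, W)) (t : I) :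
    volterra W f t = ∫ s in (0 : ℝ)..t, f.extendI s := rfl

open ContinuousMap in
lemma norm_iterate_volterra_le (G : C(I, W →L[ℝ] W)) (n : ℕ) (f : C(I, W)) (t : I) :
    ‖(((volterra W).comp (applyFamilyL I W W G)) ^ n) f t‖ ≤ (‖G‖ * t) ^ n / n.factorial * ‖f‖ := by
  induction n generalizing t with
  | zero => simpa using f.norm_coe_le_norm t
  | succ n ih =>
    rw [pow_succ', mul_apply_eq_comp, ContinuousLinearMap.comp_apply, volterra_apply]
    set h := (((volterra W).comp (applyFamilyL I W W G)) ^ n) f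
    have h0 := t.2.1
    have key : ∀ s ∈ Ioc (0 : ℝ) t, ‖(applyFamilyL I W W G h).extendI s‖ ≤
        ‖G‖ * ((‖G‖ * s) ^ n / n.factorial * ‖f‖) := by
      intro s hs
      have hs' : s ∈ Icc (0 : ℝ) 1 := ⟨hs.1.le, hs.2.trans t.2.2⟩
      rw [extendI_of_mem _ hs', applyFamilyL_apply]
      exact (G _).le_of_opNorm_le_of_le (G.norm_coe_le_norm _) (ih ⟨s, hs'⟩)
    refine (intervalIntegral.norm_integral_le_of_norm_le h0
      (Eventually.of_forall key) (Continuous.intervalIntegrable (by fun_prop) _ _)).trans ?_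
    have : (fun s : ℝ => ‖G‖ * ((‖G‖ * s) ^ n / n.factorial * ‖f‖)) =
        fun s => (‖G‖ ^ (n + 1) / n.factorial * ‖f‖) * s ^ n := by
      ext s; ring
    rw [this, intervalIntegral.integral_const_mul, integral_pow, Nat.factorial_succ]
    push_cast
    apply le_of_eq
    have : (n.factorial : ℝ) ≠ 0 := by positivity
    field_simp
    ring

lemma isUnit_one_sub_of_norm_pow_lt_one {X : Type*} [NormedAddCommGroup X] [NormedSpace ℝ X]
    [CompleteSpace X] {K : X →L[ℝ] X} {n : ℕ} (h : ‖K ^ n‖ < 1) : IsUnit (1 - K) := by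
  have hu : IsUnit (1 - K ^ n) := isUnit_one_sub_of_norm_lt_one h
  have hcomm : Commute (1 - K) (∑ i ∈ Finset.range n, K ^ i) :=
    (Commute.sum_right _ _ _ fun i _ =>
      ((Commute.one_left _).sub_left ((Commute.refl K).pow_right i)))
  rw [← mul_neg_geom_sum, hcomm.isUnit_mul_iff] at hu
  exact hu.1

lemma ContDiff.clm_ringInverse {E X : Type*} [NormedAddCommGroup E] [NormedSpace ℝ E]
    [NormedAddCommGroup X] [NormedSpace ℝ X] [CompleteSpace X] {K : E → X →L[ℝ] X}
    {n : WithTop ℕ∞} (hK : ContDiff ℝ n K) (hunit : ∀ x, IsUnit (K x)) :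
    ContDiff ℝ n fun x => Ring.inverse (K x) := by
  refine contDiff_iff_contDiffAt.2 fun x => ?_
  obtain ⟨v, hv⟩ := hunit x
  have h1 : ContDiffAt ℝ n Ring.inverse (K x) := hv ▸ contDiffAt_ringInverse ℝ v
  exact h1.comp x hK.contDiffAt

open ContinuousMap in
lemma isUnit_one_sub_volterra [CompleteSpace W] (G : C(I, W →L[ℝ] W)) :
    IsUnit (1 - (volterra W).comp (applyFamilyL I W W G)) := by
  set K := (volterra W).comp (applyFamilyL I W W G) with hK
  obtain ⟨n, hn⟩ : ∃ n : ℕ, ‖G‖ ^ n / n.factorial < 1 :=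
    ((FloorSemiring.tendsto_pow_div_factorial_atTop ‖G‖).eventually_lt_const one_pos).exists
  have hle : ‖K ^ n‖ ≤ ‖G‖ ^ n / n.factorial := by
    refine ContinuousLinearMap.opNorm_le_bound _ (by positivity) fun f => ?_
    rw [ContinuousMap.norm_le _ (by positivity)]
    intro t
    refine (norm_iterate_volterra_le G n f t).trans ?_
    have h0 := t.2.1
    have h1 := t.2.2
    gcongr
    nlinarith [norm_nonneg G]
  have hu := isUnit_one_sub_of_norm_pow_lt_one (hle.trans_lt hn)
  exact hu
end

open ContinuousMap in
/-- Smooth linear ordinary differential equations have solutions depending smoothly on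
parameters. -/
lemma exists_contDiff_linear_ode {E W : Type u} [NormedAddCommGroup E] [NormedSpace ℝ E]
    [NormedAddCommGroup W] [NormedSpace ℝ W] [CompleteSpace W] {a : E × ℝ → W →L[ℝ] W}
    (ha : ContDiff ℝ ∞ a) (w : W) :
    ∃ Y : E → C(I, W), ContDiff ℝ ∞ Y ∧
      ∀ x (f : C(I, W)), f = Y x ↔
        ∀ t : I, f t = w + ∫ s in (0 : ℝ)..t, a (x, s) (f.extendI s) := by
  set K : E → C(I, W) →L[ℝ] C(I, W) := fun x =>
    (volterra W).comp (applyFamilyL I W W (pathFamily a ha.continuous x)) with hK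
  have hKs : ContDiff ℝ ∞ K :=
    contDiff_const.clm_comp (contDiff_const.clm_apply (contDiff_pathFamily ha))
  have hunit : ∀ x, IsUnit (1 - K x) := fun x => isUnit_one_sub_volterra _
  refine ⟨fun x => Ring.inverse (1 - K x) (.const I w), ?_, fun x f => ?_⟩
  · exact ((contDiff_const.sub hKs).clm_ringInverse hunit).clm_apply contDiff_const
  · have h1 : f = Ring.inverse (1 - K x) (.const I w) ↔ (1 - K x) f = .const I w := by
      constructor
      · rintro rfl
        rw [← mul_apply_eq_comp, Ring.mul_inverse_cancel _ (hunit x)]; rfl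
      · intro h
        rw [← h, ← mul_apply_eq_comp, Ring.inverse_mul_cancel _ (hunit x)]; rfl
    rw [h1, ContinuousMap.ext_iff]
    refine forall_congr' fun t => ?_
    have h2 : K x f t = ∫ s in (0 : ℝ)..t, a (x, s) (f.extendI s) := by
      rw [hK]
      simp only [ContinuousLinearMap.comp_apply]
      rw [volterra_apply]
      refine intervalIntegral.integral_congr fun s hs => ?_
      rw [uIcc_of_le t.2.1] at hs
      have hs' : s ∈ Icc (0 : ℝ) 1 := ⟨hs.1, hs.2.trans t.2.2⟩
      simp only [extendI_of_mem _ hs', applyFamilyL_apply, pathFamily_apply]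
    rw [← h2]
    simp only [_root_.sub_apply, one_apply_eq_self,
      ContinuousMap.sub_apply, ContinuousMap.const_apply]
    exact sub_eq_iff_eq_add

/-- Parallel transport along rays from the origin: a smooth `u` solving the radial part of
`du = A u`. -/
lemma exists_contDiff_radial_transport {E W : Type u} [NormedAddCommGroup E] [NormedSpace ℝ E]
    [NormedAddCommGroup W] [NormedSpace ℝ W] [CompleteSpace W] {A : E → E →L[ℝ] W →L[ℝ] W}
    (hA : ContDiff ℝ ∞ A) (w : W) :
    ∃ u : E → W, ContDiff ℝ ∞ u ∧ u 0 = w ∧ ∀ x, fderiv ℝ u x x = A x x (u x) := by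
  have ha : ContDiff ℝ ∞ (fun p : E × ℝ => A (p.2 • p.1) p.1) := by fun_prop
  obtain ⟨Y, hY, hYu⟩ := exists_contDiff_linear_ode ha w
  have hY1 : ∀ x (t : I), Y x t = w + ∫ s in (0 : ℝ)..t, A (s • x) x ((Y x).extendI s) :=
    fun x => (hYu x (Y x)).1 rfl
  have hcont : ∀ x, Continuous fun s : ℝ => A (s • x) x ((Y x).extendI s) := fun x =>
    ((ha.continuous.comp (Continuous.prodMk_right x))).clm_apply (Y x).continuous_extendI
  have hscale : ∀ x (t : I), Y ((t : ℝ) • x) 1 = Y x t := by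
    intro x t
    have h1 : (⟨fun s => Y x (t * s), by fun_prop⟩ : C(I, W)) = Y ((t : ℝ) • x) := by
      rw [hYu]
      intro s
      rw [ContinuousMap.coe_mk, hY1]
      congr 1
      have h2 := intervalIntegral.smul_integral_comp_mul_left (a := (0 : ℝ)) (b := s)
        (fun s : ℝ => A (s • x) x ((Y x).extendI s)) (t : ℝ)
      rw [mul_zero] at h2
      rw [Icc.coe_mul, ← h2, ← intervalIntegral.integral_smul]
      refine intervalIntegral.integral_congr fun r hr => ?_
      rw [uIcc_of_le s.2.1] at hr
      have hr' : r ∈ Icc (0 : ℝ) 1 := ⟨hr.1, hr.2.trans s.2.2⟩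
      have htr : (t : ℝ) * r ∈ Icc (0 : ℝ) 1 :=
        ⟨mul_nonneg t.2.1 hr.1, mul_le_one₀ t.2.2 hr.1 hr'.2⟩
      simp only [ContinuousMap.extendI_of_mem _ hr',
        ContinuousMap.coe_mk, map_smul, smul_apply, smul_smul, mul_comm (t : ℝ) r]
      congr! 1
      rw [mul_comm r, ContinuousMap.extendI_of_mem _ htr]
      rfl
    rw [← h1]
    simp
  have hu : ContDiff ℝ ∞ fun x => Y x 1 := by
    have h1 : ContDiff ℝ ∞ fun x => (ContinuousMap.evalCLM ℝ (1 : I) : C(I, W) →L[ℝ] W) (Y x) :=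
      contDiff_const.clm_apply hY
    exact h1
  refine ⟨fun x => Y x 1, hu, ?_, fun x => ?_⟩
  · have := hscale 0 0
    have h0 := hY1 0 0
    simp at this h0
    exact this.trans h0
  · have hd : HasDerivAt (fun t : ℝ => Y (t • x) 1) (fderiv ℝ (fun x => Y x 1) x x) 1 := by
      have h1 : HasFDerivAt (fun x => Y x 1) (fderiv ℝ (fun x => Y x 1) x) ((1 : ℝ) • x) := by
        rw [one_smul]
        exact (hu.differentiable (by simp) x).hasFDerivAt
      have h2 : HasDerivAt (fun t : ℝ => t • x) x 1 := by
        simpa using (hasDerivAt_id (1 : ℝ)).smul_const x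
      exact h1.comp_hasDerivAt (1 : ℝ) h2
    have hd2 : HasDerivAt (fun t : ℝ => w + ∫ s in (0 : ℝ)..t, A (s • x) x ((Y x).extendI s))
        (A x x (Y x 1)) 1 := by
      have h1 := ((hcont x).integral_hasStrictDerivAt 0 1).hasDerivAt.const_add w
      have h2 : (Y x).extendI 1 = Y x 1 := by
        rw [ContinuousMap.extendI_of_mem _ (right_mem_Icc.2 zero_le_one)]
        rfl
      simpa [h2] using h1
    have huniq : UniqueDiffWithinAt ℝ (Icc (0 : ℝ) 1) 1 :=
      uniqueDiffOn_Icc zero_lt_one 1 (right_mem_Icc.2 zero_le_one)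
    refine huniq.eq_deriv _ hd.hasDerivWithinAt (hd2.hasDerivWithinAt.congr_of_mem ?_
      (right_mem_Icc.2 zero_le_one))
    intro t ht
    exact (hscale x ⟨t, ht⟩).trans (hY1 x ⟨t, ht⟩)

/-- Frobenius integrability for linear systems: a flat connection on a star-shaped set has parallel
sections with prescribed value at the origin. The sections are smooth on the whole space. -/
theorem exists_contDiff_parallel_section {E W : Type u} [NormedAddCommGroup E] [NormedSpace ℝ E]
    [NormedAddCommGroup W] [NormedSpace ℝ W] [CompleteSpace W] {A : E → E →L[ℝ] W →L[ℝ] W}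
    (hA : ContDiff ℝ ∞ A) {S : Set E} (hS : StarConvex ℝ 0 S)
    (hflat : ∀ x ∈ S, ∀ v v' : E, ∀ z : W, fderiv ℝ A x v v' z + A x v' (A x v z) =
      fderiv ℝ A x v' v z + A x v (A x v' z)) (w : W) :
    ∃ u : E → W, ContDiff ℝ ∞ u ∧ u 0 = w ∧ ∀ x ∈ S, ∀ v, fderiv ℝ u x v = A x v (u x) := by
  obtain ⟨u, hu, hu0, hrad⟩ := exists_contDiff_radial_transport hA w
  refine ⟨u, hu, hu0, fun x hx v => ?_⟩
  have hAd : Differentiable ℝ A := hA.differentiable (by simp)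
  have hud : Differentiable ℝ u := hu.differentiable (by simp)
  have hu1 : ContDiff ℝ ∞ (fderiv ℝ u) := hu.fderiv_right (by simp)
  have hu1d : Differentiable ℝ (fderiv ℝ u) := hu1.differentiable (by simp)
  -- the defect `δ t = D (t x) v`, with `D y v = du_y(v) - A y v (u y)`
  have hsym : ∀ y a b, fderiv ℝ (fderiv ℝ u) y a b = fderiv ℝ (fderiv ℝ u) y b a := fun y a b =>
    (hu.contDiffAt.isSymmSndFDerivAt (by
      rw [minSmoothness_of_isRCLikeNormedField]
      exact WithTop.coe_le_coe.2 (le_top : (2 : ℕ∞) ≤ ⊤))) a b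
  -- differentiating the radial equation in the direction `v`
  have hradv : ∀ y, fderiv ℝ (fderiv ℝ u) y v y + fderiv ℝ u y v =
      fderiv ℝ A y v y (u y) + A y v (u y) + A y y (fderiv ℝ u y v) := by
    intro y
    have h1 := (hu1d y).hasFDerivAt.clm_apply (hasFDerivAt_id y)
    have h2 := ((hAd y).hasFDerivAt.clm_apply (hasFDerivAt_id y)).clm_apply (hud y).hasFDerivAt
    have h3 : (fun y => fderiv ℝ u y (id y)) = fun y => A y (id y) (u y) := funext hrad
    rw [h3] at h1
    have h4 := congrArg (fun L : E →L[ℝ] W => L v) (h1.unique h2)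
    simp only [id_eq, add_apply, ContinuousLinearMap.comp_apply, ContinuousLinearMap.flip_apply,
      ContinuousLinearMap.id_apply] at h4
    rw [add_comm, h4]
    abel
  have hkey : ∀ t ∈ Icc (0 : ℝ) 1, HasDerivAt
      (fun t : ℝ => t • (fderiv ℝ u (t • x) v - A (t • x) v (u (t • x))))
      (A (t • x) x (t • (fderiv ℝ u (t • x) v - A (t • x) v (u (t • x))))) t := by
    intro t ht
    have hmem : t • x ∈ S := hS.smul_mem hx ht.1 ht.2
    have hl : HasDerivAt (fun t : ℝ => t • x) x t := by
      simpa using (hasDerivAt_id t).smul_const x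
    have h1 : HasDerivAt (fun t : ℝ => fderiv ℝ u (t • x) v)
        (fderiv ℝ (fderiv ℝ u) (t • x) x v) t := by
      have h : HasDerivAt (fun t : ℝ => fderiv ℝ u (t • x)) (fderiv ℝ (fderiv ℝ u) (t • x) x) t :=
        (hu1d (t • x)).hasFDerivAt.comp_hasDerivAt t hl
      simpa using h.clm_apply (hasDerivAt_const t v)
    have h2 : HasDerivAt (fun t : ℝ => A (t • x) v) (fderiv ℝ A (t • x) x v) t := by
      have h : HasDerivAt (fun t : ℝ => A (t • x)) (fderiv ℝ A (t • x) x) t :=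
        HasFDerivAt.comp_hasDerivAt (l := A) t (hAd (t • x)).hasFDerivAt hl
      simpa using h.clm_apply (hasDerivAt_const t v)
    have h3 : HasDerivAt (fun t : ℝ => u (t • x)) (fderiv ℝ u (t • x) x) t :=
      (hud (t • x)).hasFDerivAt.comp_hasDerivAt t hl
    refine ((hasDerivAt_id t).smul (h1.sub (h2.clm_apply h3))).congr_deriv ?_
    have e1 := hradv (t • x)
    have e2 := hflat _ hmem v x (u (t • x))
    have e3 := hrad (t • x)
    have e4 := hsym (t • x) x v
    simp only [map_smul, smul_apply] at e1 e3
    simp only [id_eq, one_smul, map_smul, map_sub, smul_sub, smul_add, Pi.sub_apply]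
    rw [e4]
    have e5 := congrArg (fun z => t • z) e2
    have e6 := congrArg (A (t • x) v) e3
    simp only [smul_add, map_smul] at e5 e6
    linear_combination (norm := module) e1 + e5 - e6
  obtain ⟨C, hC⟩ : ∃ C : ℝ, ∀ t ∈ Icc (0 : ℝ) 1, ‖A (t • x) x‖ ≤ C := by
    have : Continuous fun t : ℝ => A (t • x) x := by
      have := hA.continuous
      fun_prop
    exact isCompact_Icc.exists_bound_of_continuousOn this.continuousOn
  have hzero := eq_zero_of_abs_deriv_le_mul_abs_self_of_eq_zero_right (K := C)
    (fun t ht => (hkey t ht).continuousAt.continuousWithinAt)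
    (fun t ht => (hkey t (Ico_subset_Icc_self ht)).hasDerivWithinAt) (by simp)
    (fun t ht => (A (t • x) x).le_of_opNorm_le (hC t (Ico_subset_Icc_self ht)) _) 1
    (right_mem_Icc.2 zero_le_one)
  simpa [sub_eq_zero] using hzero

end ParallelSections

section Ball
open Set Filter Topology Metric
open scoped ContDiff

variable {E : Type*} [NormedAddCommGroup E] [NormedSpace ℝ E] [FiniteDimensional ℝ E]
  {F : E → E} {e : E → E ≃L[ℝ] E}

lemma image_ball_eq [Nontrivial E]
    (he : ∀ x ∈ closedBall (0 : E) 1, HasStrictFDerivAt F (e x : E →L[ℝ] E) x)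
    (hS : ∀ x ∈ sphere (0 : E) 1, ‖F x‖ = 1) : F '' ball 0 1 = ball 0 1 := by
  have hc : ContinuousOn F (closedBall 0 1) := fun x hx =>
    (he x hx).continuousAt.continuousWithinAt
  have hK : IsCompact (closedBall (0 : E) 1) := isCompact_closedBall 0 1
  have hopen : IsOpen (F '' ball 0 1) := by
    rw [isOpen_iff_mem_nhds]
    rintro _ ⟨x, hx, rfl⟩
    rw [← (he x (ball_subset_closedBall hx)).map_nhds_eq_of_equiv]
    exact image_mem_map (isOpen_ball.mem_nhds hx)
  have hle : ∀ x ∈ closedBall (0 : E) 1, ‖F x‖ ≤ 1 := by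
    obtain ⟨p, hp, hmax⟩ := hK.exists_isMaxOn ⟨0, by simp⟩ hc.norm
    suffices hp1 : ‖F p‖ ≤ 1 from fun x hx => (hmax hx).trans hp1
    by_cases hpS : p ∈ sphere (0 : E) 1
    · exact (hS p hpS).le
    have hpb : p ∈ ball (0 : E) 1 := by
      rw [← closedBall_sdiff_sphere]
      exact ⟨hp, hpS⟩
    have hsub : F '' ball 0 1 ⊆ closedBall 0 ‖F p‖ := by
      rintro _ ⟨x, hx, rfl⟩
      simpa using hmax (ball_subset_closedBall hx)
    have h1 := interior_maximal hsub hopen (mem_image_of_mem F hpb)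
    rcases eq_or_ne ‖F p‖ 0 with h0 | h0
    · exact h0.le.trans zero_le_one
    · rw [interior_closedBall _ h0] at h1
      simp at h1
  have hsub : F '' ball 0 1 ⊆ ball 0 1 := by
    refine (interior_maximal ?_ hopen).trans_eq (interior_closedBall (0 : E) one_ne_zero)
    rintro _ ⟨x, hx, rfl⟩
    simpa using hle x (ball_subset_closedBall hx)
  refine hsub.antisymm ((convex_ball (0 : E) 1).isPreconnected.subset_of_closure_inter_subset hopen
    ⟨F 0, hsub (mem_image_of_mem F (by simp)), mem_image_of_mem F (by simp)⟩ ?_)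
  rintro y ⟨hy, hyb⟩
  obtain ⟨x, hx, rfl⟩ := closure_minimal (image_mono ball_subset_closedBall)
    (hK.image_of_continuousOn hc).isClosed hy
  refine mem_image_of_mem F ?_
  rw [← closedBall_sdiff_sphere]
  refine ⟨hx, fun hxS => ?_⟩
  rw [mem_ball_zero_iff, hS x hxS] at hyb
  exact lt_irrefl _ hyb

lemma injOn_ball [Nontrivial E]
    (he : ∀ x ∈ closedBall (0 : E) 1, HasStrictFDerivAt F (e x : E →L[ℝ] E) x)
    (hS : ∀ x ∈ sphere (0 : E) 1, ‖F x‖ = 1) : InjOn F (ball 0 1) := by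
  have himg := image_ball_eq he hS
  have hmaps : MapsTo F (ball 0 1) (ball 0 1) := mapsTo_iff_image_subset.2 himg.subset
  have hc : ContinuousOn F (closedBall 0 1) := fun x hx =>
    (he x hx).continuousAt.continuousWithinAt
  have : CompactSpace (closedBall (0 : E) 1) :=
    isCompact_iff_compactSpace.1 (isCompact_closedBall 0 1)
  set p : closedBall (0 : E) 1 → E := (closedBall (0 : E) 1).domRestrict F with hp
  have hpc : Continuous p := continuousOn_iff_continuous_domRestrict.1 hc
  have hloc : ∀ x ∈ closedBall (0 : E) 1, ∃ u ∈ 𝓝 x, InjOn F u := fun x hx =>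
    ⟨_, ((he x hx).toOpenPartialHomeomorph F).open_source.mem_nhds
      (he x hx).mem_toOpenPartialHomeomorph_source,
      ((he x hx).toOpenPartialHomeomorph F).injOn⟩
  have hball : ∀ x : closedBall (0 : E) 1, p x ∈ ball (0 : E) 1 → (x : E) ∈ ball (0 : E) 1 := by
    intro x hx
    rw [← closedBall_sdiff_sphere]
    refine ⟨x.2, fun hxS => ?_⟩
    have := hS x hxS
    rw [mem_ball_zero_iff] at hx
    exact hx.ne this
  have hcov : IsCoveringMapOn p (ball 0 1) := by
    refine .of_isLocalHomeomorphOn hpc ((isLocalHomeomorphOn_iff_isOpenEmbedding_restrict _).2 ?_)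
    intro x hx
    have hxb : (x : E) ∈ ball (0 : E) 1 := hball x hx
    obtain ⟨u, hu, huF⟩ := hloc x x.2
    obtain ⟨o, hou, ho, hxo⟩ := _root_.mem_nhds_iff.1 (inter_mem hu (isOpen_ball.mem_nhds hxb))
    refine ⟨Subtype.val ⁻¹' o, (ho.preimage continuous_subtype_val).mem_nhds hxo,
      .of_continuous_injective_isOpenMap (hpc.comp continuous_subtype_val) ?_ ?_⟩
    · intro y z hyz
      exact Subtype.ext (Subtype.ext (huF (hou y.2).1 (hou z.2).1 hyz))
    · rw [isOpenMap_iff_nhds_le]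
      intro y
      have h1 : map (Subtype.val ∘ Subtype.val) (𝓝 y) = 𝓝 ((y : closedBall (0 : E) 1) : E) := by
        rw [← map_map, map_nhds_subtype_coe_eq_nhds y.2
          ((ho.preimage continuous_subtype_val).mem_nhds y.2),
          map_nhds_subtype_coe_eq_nhds y.1.2 (closedBall_mem_nhds_of_mem (hou y.2).2)]
      change 𝓝 (F y.1.1) ≤ map (F ∘ (Subtype.val ∘ Subtype.val)) (𝓝 y)
      rw [← map_map, h1, (he _ y.1.2).map_nhds_eq_of_equiv]
  have hne : (ball (0 : E) 1).Nonempty := ⟨0, by simp⟩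
  have : ContractibleSpace (ball (0 : E) 1) := (convex_ball (0 : E) 1).contractibleSpace hne
  have : LocallyPathConnectedSpace (ball (0 : E) 1) := isOpen_ball.locallyPathConnectedSpace
  have h0 : (0 : E) ∈ ball (0 : E) 1 := by simp
  obtain ⟨σ, ⟨hσ0, hσ⟩, -⟩ := hcov.existsUnique_continuousMap_lifts
    (⟨Subtype.val, continuous_subtype_val⟩ : C(ball (0 : E) 1, E))
    (a₀ := ⟨F 0, hmaps h0⟩) (e₀ := ⟨0, ball_subset_closedBall h0⟩) rfl (fun a => a.2)
  have hσF : ∀ y : ball (0 : E) 1, F (σ y) = y := fun y => congrFun hσ y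
  let P : ball (0 : E) 1 → ball (0 : E) 1 := hmaps.restrict
  have hPc : Continuous P := (hc.mono ball_subset_closedBall).mapsToRestrict hmaps
  have hclopen : IsClopen {x : ball (0 : E) 1 | (σ (P x) : E) = x} := by
    refine ⟨isClosed_eq (by fun_prop) (by fun_prop), isOpen_iff_mem_nhds.2 fun x hx => ?_⟩
    obtain ⟨u, hu, huF⟩ := hloc x (ball_subset_closedBall x.2)
    have h1 : Continuous fun x => (σ (P x) : E) := by fun_prop
    have h2 := h1.continuousAt.preimage_mem_nhds (x := x) (t := u) (by rwa [show _ = _ from hx])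
    filter_upwards [h2, continuous_subtype_val.continuousAt.preimage_mem_nhds hu] with z hz hz'
    exact huF hz hz' (hσF (P z))
  have : PreconnectedSpace (ball (0 : E) 1) :=
    isPreconnected_iff_preconnectedSpace.1 (convex_ball (0 : E) 1).isPreconnected
  have huniv := hclopen.eq_univ ⟨⟨0, h0⟩, congrArg Subtype.val hσ0⟩
  intro x hx y hy hxy
  have hx' : (σ (P ⟨x, hx⟩) : E) = x := (eq_univ_iff_forall.1 huniv ⟨x, hx⟩)
  have hy' : (σ (P ⟨y, hy⟩) : E) = y := (eq_univ_iff_forall.1 huniv ⟨y, hy⟩)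
  rw [← hx', ← hy', show P ⟨x, hx⟩ = P ⟨y, hy⟩ from Subtype.ext hxy]

end Ball

section Ball
open Set Filter Topology Metric
open scoped ContDiff

variable {E : Type*} [NormedAddCommGroup E] [InnerProductSpace ℝ E] [FiniteDimensional ℝ E]
  {F : E → E}

lemma injOn_closedBall [Nontrivial E] (hF : ContDiff ℝ ∞ F)
    (he : ∀ x ∈ closedBall (0 : E) 1, (fderiv ℝ F x).IsInvertible)
    (hS : ∀ x ∈ sphere (0 : E) 1, ‖F x‖ = 1) : InjOn F (closedBall 0 1) := by
  have hstrict : ∀ x ∈ closedBall (0 : E) 1, ∃ e : E ≃L[ℝ] E,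
      fderiv ℝ F x = e ∧ HasStrictFDerivAt F (e : E →L[ℝ] E) x := fun x hx => by
    obtain ⟨e, hex⟩ := he x hx
    exact ⟨e, hex.symm, hex ▸ hF.contDiffAt.hasStrictFDerivAt (by simp)⟩
  choose! e hfe hFe using hstrict
  have hinj := injOn_ball hFe hS
  have himg := image_ball_eq hFe hS
  have hcont : ContinuousOn (fun x => ‖(fderiv ℝ F x).inverse‖) (closedBall 0 1) := by
    intro x hx
    have h1 : ContinuousAt (ContinuousLinearMap.inverse (R := ℝ) (M := E) (M₂ := E))
        (fderiv ℝ F x) := by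
      rw [hfe x hx]
      exact (contDiffAt_map_inverse (n := 1) (e x)).continuousAt
    have h2 : ContinuousAt (fderiv ℝ F) x := (hF.continuous_fderiv (by simp)).continuousAt
    exact (ContinuousAt.comp (f := fderiv ℝ F) h1 h2).norm.continuousWithinAt
  obtain ⟨C, hC⟩ := (isCompact_closedBall (0 : E) 1).bddAbove_image hcont
  have hinv : ∀ x ∈ ball (0 : E) 1, Function.invFunOn F (ball 0 1) (F x) = x := fun x hx =>
    hinj.leftInvOn_invFunOn hx
  have hlip : ∀ x ∈ ball (0 : E) 1, ∀ y ∈ ball (0 : E) 1, ‖x - y‖ ≤ C * ‖F x - F y‖ := by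
    intro x hx y hy
    rw [← hinv x hx, ← hinv y hy, hinv x hx, hinv y hy]
    have h1 : ∀ z ∈ ball (0 : E) 1, ∃ L : E →L[ℝ] E, ‖L‖ ≤ C ∧
        HasFDerivWithinAt (Function.invFunOn F (ball 0 1)) L (ball 0 1) z := by
      intro z hz
      obtain ⟨p, hp, rfl⟩ := himg.symm.subset hz
      have hpb := ball_subset_closedBall hp
      refine ⟨(e p).symm, ?_, ((hFe p hpb).to_local_left_inverse ?_).hasFDerivAt.hasFDerivWithinAt⟩
      · have := hC (mem_image_of_mem _ hpb)
        rwa [hfe p hpb, ContinuousLinearMap.inverse_equiv] at this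
      · filter_upwards [isOpen_ball.mem_nhds hp] with q hq using hinv q hq
    choose! L hL1 hL2 using h1
    have h2 := (convex_ball (0 : E) 1).norm_image_sub_le_of_norm_hasFDerivWithin_le hL2 hL1
      (himg.subset (mem_image_of_mem F hy)) (himg.subset (mem_image_of_mem F hx))
    rwa [hinv x hx, hinv y hy] at h2
  have hlip' : ∀ z ∈ closedBall (0 : E) 1 ×ˢ closedBall (0 : E) 1,
      ‖z.1 - z.2‖ ≤ C * ‖F z.1 - F z.2‖ := by
    intro z hz
    have hFc := hF.continuous
    rw [← closure_ball (0 : E) one_ne_zero, ← closure_prod_eq] at hz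
    exact closure_minimal (fun z hz => hlip z.1 hz.1 z.2 hz.2)
      (isClosed_le (f := fun z : E × E => ‖z.1 - z.2‖)
        (g := fun z : E × E => C * ‖F z.1 - F z.2‖) (by fun_prop) (by fun_prop)) hz
  intro x hx y hy hxy
  have := hlip' (x, y) ⟨hx, hy⟩
  simp only [hxy, sub_self, norm_zero, mul_zero] at this
  exact sub_eq_zero.1 (norm_le_zero_iff.1 this)

/-- A smooth map which is an immersion on the closed unit ball and maps the unit sphere into
itself has, on the closed ball, a globally defined smooth inverse. -/
lemma exists_contDiff_inverse_on_closedBall [Nontrivial E] (hF : ContDiff ℝ ∞ F)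
    (he : ∀ x ∈ closedBall (0 : E) 1, (fderiv ℝ F x).IsInvertible)
    (hS : ∀ x ∈ sphere (0 : E) 1, ‖F x‖ = 1) :
    ∃ φ : E → E, ContDiff ℝ ∞ φ ∧ BijOn φ (closedBall 0 1) (closedBall 0 1) ∧
      ∀ y ∈ closedBall (0 : E) 1, F ∘ φ =ᶠ[𝓝 y] id := by
  have hinj := injOn_closedBall hF he hS
  have himg : F '' closedBall 0 1 = closedBall 0 1 := by
    have hstrict : ∀ x ∈ closedBall (0 : E) 1, ∃ e : E ≃L[ℝ] E,
        HasStrictFDerivAt F (e : E →L[ℝ] E) x := fun x hx => by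
      obtain ⟨e, hex⟩ := he x hx
      exact ⟨e, hex ▸ hF.contDiffAt.hasStrictFDerivAt (by simp)⟩
    choose! e hFe using hstrict
    rw [← closure_ball (0 : E) one_ne_zero]
    conv_rhs => rw [← image_ball_eq hFe hS]
    refine (image_closure_of_isCompact ?_ hF.continuous.continuousOn)
    rw [closure_ball (0 : E) one_ne_zero]
    exact isCompact_closedBall 0 1
  have hloc : ∀ x, (fderiv ℝ F x).IsInvertible → ∃ e : E ≃L[ℝ] E,
      HasFDerivAt F (e : E →L[ℝ] E) x ∧ HasStrictFDerivAt F (e : E →L[ℝ] E) x := fun x hx => by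
    obtain ⟨e, hex⟩ := hx
    have := hex ▸ hF.contDiffAt.hasStrictFDerivAt (x := x) (by simp)
    exact ⟨e, this.hasFDerivAt, this⟩
  obtain ⟨t₀, ht₀, hbt₀, hinj₀⟩ := hinj.exists_isOpen_superset (isCompact_closedBall 0 1)
    (fun x _ => hF.continuous.continuousAt) (fun x hx => by
      obtain ⟨e, -, h⟩ := hloc x (he x hx)
      exact ⟨_, (h.toOpenPartialHomeomorph F).open_source.mem_nhds
        h.mem_toOpenPartialHomeomorph_source, (h.toOpenPartialHomeomorph F).injOn⟩)
  set t : Set E := t₀ ∩ {x | (fderiv ℝ F x).IsInvertible} with ht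
  have hto : IsOpen t := ht₀.inter
    (ContinuousLinearEquiv.isOpen.preimage (hF.continuous_fderiv (by simp)))
  have hbt : closedBall 0 1 ⊆ t := fun x hx => ⟨hbt₀ hx, he x hx⟩
  have hinjt : InjOn F t := hinj₀.mono inter_subset_left
  have hFto : IsOpen (F '' t) := by
    rw [isOpen_iff_mem_nhds]
    rintro _ ⟨x, hx, rfl⟩
    obtain ⟨e, -, h⟩ := hloc x hx.2
    rw [← h.map_nhds_eq_of_equiv]
    exact image_mem_map (hto.mem_nhds hx)
  set ψ : E → E := Function.invFunOn F t with hψ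
  have hψF : ∀ x ∈ t, ψ (F x) = x := fun x hx => hinjt.leftInvOn_invFunOn hx
  have hFψ : ∀ y ∈ F '' t, F (ψ y) = y := fun y hy => Function.invFunOn_eq hy
  have hψC : ∀ y ∈ F '' t, ContDiffAt ℝ ∞ ψ y := by
    rintro _ ⟨x, hx, rfl⟩
    obtain ⟨e, h1, h2⟩ := hloc x hx.2
    have h3 := hF.contDiffAt.to_localInverse h1 (by simp)
    refine h3.congr_of_eventuallyEq (h2.localInverse_unique ?_)
    filter_upwards [hto.mem_nhds hx] with z hz using hψF z hz
  have hbFt : closedBall 0 1 ⊆ F '' t := himg.symm.subset.trans (image_mono hbt)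
  obtain ⟨δ, hδ, hδt⟩ := (isCompact_closedBall (0 : E) 1).exists_cthickening_subset_open hFto hbFt
  rw [cthickening_closedBall hδ.le zero_le_one] at hδt
  let χ : ContDiffBump (0 : E) := ⟨1 + δ / 3, 1 + δ / 2, by linarith, by linarith⟩
  have hχ : ∀ y ∈ closedBall (0 : E) 1, (fun z => χ z • ψ z) =ᶠ[𝓝 y] ψ := by
    intro y hy
    have hy' : y ∈ ball (0 : E) (1 + δ / 3) := closedBall_subset_ball (by linarith) hy
    filter_upwards [isOpen_ball.mem_nhds hy'] with z hz
    rw [χ.one_of_mem_closedBall (ball_subset_closedBall hz), one_smul]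
  refine ⟨fun z => χ z • ψ z, contDiff_iff_contDiffAt.2 fun y => ?_, ?_, fun y hy => ?_⟩
  · by_cases hy : y ∈ closedBall (0 : E) (1 + δ / 2)
    · exact χ.contDiffAt.smul (hψC y (hδt (closedBall_subset_closedBall (by linarith) hy)))
    · refine (contDiffAt_const (c := (0 : E))).congr_of_eventuallyEq ?_
      filter_upwards [isClosed_closedBall.isOpen_compl.mem_nhds hy] with z hz
      rw [χ.zero_of_le_dist (not_le.1 (mt mem_closedBall.2 hz)).le, zero_smul]
  · have h1 : BijOn ψ (closedBall 0 1) (closedBall 0 1) := by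
      have h2 := hinj.bijOn_image
      rw [himg] at h2
      refine h2.symm ⟨fun y hy => ?_, fun x hx => hψF x (hbt hx)⟩
      exact hFψ y (hbFt hy)
    exact h1.congr fun y hy => (hχ y hy).symm.eq_of_nhds
  · filter_upwards [hχ y hy, hFto.mem_nhds (hbFt hy)] with z hz hz'
    simp only [Function.comp_apply, hz, id_eq]
    exact hFψ z hz'

end Ball

namespace Stmt12

section

open Set Filter Topology
open scoped ContDiff

lemma fderiv_eq_sum_pd (f : V3 → ℝ) (x v : V3) : fderiv ℝ f x v = ∑ i, v i * pd i f x := by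
  conv_lhs => rw [← (EuclideanSpace.basisFun (Fin 3) ℝ).sum_repr v]
  simp [pd]

lemma hasFDerivAt_sum_smul_const {E Z κ : Type*} [Fintype κ] [NormedAddCommGroup E]
    [NormedSpace ℝ E] [NormedAddCommGroup Z] [NormedSpace ℝ Z] {a : κ → E → ℝ} {x : E}
    (ha : ∀ k, DifferentiableAt ℝ (a k) x) (C : κ → Z) :
    HasFDerivAt (fun x => ∑ k, a k x • C k) (∑ k, (fderiv ℝ (a k) x).smulRight (C k)) x :=
  HasFDerivAt.fun_sum fun k _ => (ha k).hasFDerivAt.smul_const (C k)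

lemma contDiff_sum_smul_const {E Z κ : Type*} [Fintype κ] [NormedAddCommGroup E]
    [NormedSpace ℝ E] [NormedAddCommGroup Z] [NormedSpace ℝ Z] {a : κ → E → ℝ}
    (ha : ∀ k, ContDiff ℝ ∞ (a k)) (C : κ → Z) :
    ContDiff ℝ ∞ (fun x => ∑ k, a k x • C k) :=
  ContDiff.sum fun k _ => (ha k).smul contDiff_const

/-- Frobenius integrability in a basis of the coefficients. -/
theorem exists_contDiff_parallel_sum {E W κ : Type} [Fintype κ] [NormedAddCommGroup E]
    [NormedSpace ℝ E] [NormedAddCommGroup W] [NormedSpace ℝ W] [CompleteSpace W]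
    {a : κ → E → ℝ} (ha : ∀ k, ContDiff ℝ ∞ (a k)) (C : κ → E →L[ℝ] W →L[ℝ] W)
    {S : Set E} (hS : StarConvex ℝ 0 S)
    (hflat : ∀ x ∈ S, ∀ v v' z,
      ∑ k, fderiv ℝ (a k) x v • C k v' z + ∑ k, ∑ l, (a k x * a l x) • C l v' (C k v z) =
      ∑ k, fderiv ℝ (a k) x v' • C k v z + ∑ k, ∑ l, (a k x * a l x) • C l v (C k v' z))
    (w : W) :
    ∃ u : E → W, ContDiff ℝ ∞ u ∧ u 0 = w ∧
      ∀ x ∈ S, ∀ v, fderiv ℝ u x v = ∑ k, a k x • C k v (u x) := by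
  have hA : ContDiff ℝ ∞ fun x => ∑ k, a k x • C k :=
    contDiff_sum_smul_const ha C
  have hdA : ∀ x, HasFDerivAt (fun x => ∑ k, a k x • C k)
      (∑ k, (fderiv ℝ (a k) x).smulRight (C k)) x := fun x =>
    hasFDerivAt_sum_smul_const (fun k => (ha k).differentiable (by simp) x) C
  obtain ⟨u, hu, hu0, hdu⟩ := exists_contDiff_parallel_section hA hS (fun x hx v v' z => by
    rw [(hdA x).fderiv]
    simpa [Finset.smul_sum, smul_smul] using hflat x hx v v' z) w
  refine ⟨u, hu, hu0, fun x hx v => ?_⟩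
  rw [hdu x hx]
  simp

/-- Frobenius integrability in coordinates. -/
theorem exists_contDiff_parallel_coords {ι : Type} [Fintype ι] [DecidableEq ι]
    {a : Fin 3 → ι → ι → V3 → ℝ} (ha : ∀ i α β, ContDiff ℝ ∞ (a i α β))
    (hflat : ∀ x ∈ Metric.closedBall (0 : V3) 1, ∀ i j α γ,
      pd i (a j α γ) x + ∑ β, a j α β x * a i β γ x =
        pd j (a i α γ) x + ∑ β, a i α β x * a j β γ x) (w : ι → ℝ) :
    ∃ u : ι → V3 → ℝ, (∀ α, ContDiff ℝ ∞ (u α)) ∧ (∀ α, u α 0 = w α) ∧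
      ∀ x ∈ Metric.closedBall (0 : V3) 1, ∀ i α, pd i (u α) x = ∑ β, a i α β x * u β x := by
  let C : Fin 3 × ι × ι → V3 →L[ℝ] EuclideanSpace ℝ ι →L[ℝ] EuclideanSpace ℝ ι := fun k =>
    (EuclideanSpace.proj k.1 : V3 →L[ℝ] ℝ).smulRight
      ((EuclideanSpace.proj k.2.2 : EuclideanSpace ℝ ι →L[ℝ] ℝ).smulRight
        (EuclideanSpace.single k.2.1 (1 : ℝ)))
  have hC : ∀ k v z α, C k v z α = if α = k.2.1 then v k.1 * z k.2.2 else 0 := by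
    intro k v z α
    simp [C]
  have hsum : ∀ (b : Fin 3 × ι × ι → ℝ) v z α,
      (∑ k, b k • C k v z) α = ∑ i, ∑ β, v i * (b (i, α, β) * z β) := by
    intro b v z α
    simp only [WithLp.ofLp_sum, Finset.sum_apply, PiLp.smul_apply, hC, Fintype.sum_prod_type,
      smul_eq_mul]
    refine Finset.sum_congr rfl fun i _ => ?_
    rw [Finset.sum_eq_single α]
    · exact Finset.sum_congr rfl fun β _ => by simp; ring
    · intro b _ hb
      simp [hb.symm]
    · simp
  obtain ⟨u, hu, hu0, hdu⟩ := exists_contDiff_parallel_sum (a := fun k => a k.1 k.2.1 k.2.2)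
    (fun k => ha _ _ _) C
    ((convex_closedBall (0 : V3) 1).starConvex (by simp)) (fun x hx v v' z => by
      ext α
      have h1 : ∀ v v', (∑ k : Fin 3 × ι × ι, ∑ l : Fin 3 × ι × ι,
          (a k.1 k.2.1 k.2.2 x * a l.1 l.2.1 l.2.2 x) • C l v' (C k v z)) α =
          ∑ i, ∑ j, ∑ γ, v i * v' j * z γ * ∑ β, a j α β x * a i β γ x := by
        intro v v'
        have h2 : ∑ k : Fin 3 × ι × ι, ∑ l : Fin 3 × ι × ι,
            (a k.1 k.2.1 k.2.2 x * a l.1 l.2.1 l.2.2 x) • C l v' (C k v z) =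
            ∑ l : Fin 3 × ι × ι, a l.1 l.2.1 l.2.2 x •
              C l v' (∑ k : Fin 3 × ι × ι, a k.1 k.2.1 k.2.2 x • C k v z) := by
          rw [Finset.sum_comm]
          simp [Finset.smul_sum, smul_smul, mul_comm]
        rw [h2]
        refine (hsum _ _ _ _).trans ?_
        simp only [hsum, Finset.mul_sum]
        calc _ = ∑ j, ∑ i, ∑ β, ∑ γ, v' j * (a j α β x * (v i * (a i β γ x * z γ))) :=
              Finset.sum_congr rfl fun j _ => Finset.sum_comm
          _ = ∑ i, ∑ j, ∑ β, ∑ γ, v' j * (a j α β x * (v i * (a i β γ x * z γ))) :=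
              Finset.sum_comm
          _ = _ := Finset.sum_congr rfl fun i _ => Finset.sum_congr rfl fun j _ => by
              rw [Finset.sum_comm]
              exact Finset.sum_congr rfl fun _ _ => Finset.sum_congr rfl fun _ _ => by ring
      have h3 : ∀ v v', (∑ k : Fin 3 × ι × ι,
          fderiv ℝ (a k.1 k.2.1 k.2.2) x v • C k v' z) α =
          ∑ i, ∑ j, ∑ γ, v i * v' j * z γ * pd i (a j α γ) x := by
        intro v v'
        refine (hsum (fun k => fderiv ℝ (a k.1 k.2.1 k.2.2) x v) _ _ α).trans ?_
        simp only [fderiv_eq_sum_pd, Finset.mul_sum, Finset.sum_mul]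
        calc _ = ∑ j, ∑ i, ∑ γ, v' j * (v i * pd i (a j α γ) x * z γ) :=
              Finset.sum_congr rfl fun j _ => Finset.sum_comm
          _ = ∑ i, ∑ j, ∑ γ, v' j * (v i * pd i (a j α γ) x * z γ) := Finset.sum_comm
          _ = _ := Finset.sum_congr rfl fun _ _ => Finset.sum_congr rfl fun _ _ =>
              Finset.sum_congr rfl fun _ _ => by ring
      rw [PiLp.add_apply, PiLp.add_apply, h1, h1, h3, h3]
      simp only [← Finset.sum_add_distrib, ← mul_add]
      rw [Finset.sum_comm (γ := Fin 3)]
      refine Finset.sum_congr rfl fun i _ => Finset.sum_congr rfl fun j _ =>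
        Finset.sum_congr rfl fun γ _ => ?_
      rw [hflat x hx j i α γ]
      ring) (WithLp.toLp 2 w)
  refine ⟨fun α x => u x α, contDiff_euclidean.1 hu, fun α => by simp [hu0], fun x hx i α => ?_⟩
  have h1 : HasFDerivAt (fun y => u y α) ((EuclideanSpace.proj α : _ →L[ℝ] ℝ) ∘L fderiv ℝ u x) x :=
    (EuclideanSpace.proj (𝕜 := ℝ) (ι := ι) α).hasFDerivAt.comp x
      (hu.differentiable (by simp) x).hasFDerivAt
  rw [pd, h1.fderiv, ContinuousLinearMap.comp_apply, hdu x hx]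
  refine (hsum _ _ _ α).trans ?_
  rw [Finset.sum_eq_single i]
  · simp
  · intro b _ hb
    simp [hb]
  · simp

/-- In dimension three a tensor with the antisymmetries of a curvature tensor is determined by its
Ricci contraction. -/
lemma eq_zero_of_antisymm_of_contraction_eq_zero {R : Fin 3 → Fin 3 → Fin 3 → Fin 3 → ℝ}
    {H : Fin 3 → Fin 3 → ℝ} (hH : ∀ i j, H i j = H j i) (hdet : (Matrix.of H).det ≠ 0)
    (h1 : ∀ k a b c, R k a b c = - R a k b c) (h2 : ∀ k a b c, R k a b c = - R k a c b)
    (hRic : ∀ a b, ∑ c, ∑ k, H c k * R k a c b = 0) (k a b c : Fin 3) : R k a b c = 0 := by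
  have h00 : ∀ i b c, R i i b c = 0 := fun i b c => by linarith [h1 i i b c]
  have h00' : ∀ i b c, R b c i i = 0 := fun i b c => by linarith [h2 b c i i]
  rw [Matrix.det_fin_three] at hdet
  simp only [Matrix.of_apply] at hdet
  have e : ∀ p q, ∑ b, ∑ d, (1 / 2 * H q p * H b d - H q b * H d p) *
      (∑ c, ∑ k, H c k * R k b c d) = 0 := fun p q => by simp [hRic]
  have e00 := e 0 0
  have e01 := e 0 1
  have e02 := e 0 2
  have e10 := e 1 0
  have e11 := e 1 1
  have e12 := e 1 2
  have e20 := e 2 0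
  have e21 := e 2 1
  have e22 := e 2 2
  have h10 := h1 1 0
  have h20 := h1 2 0
  have h21 := h1 2 1
  have h10' := fun b c => h2 b c 1 0
  have h20' := fun b c => h2 b c 2 0
  have h21' := fun b c => h2 b c 2 1
  simp only [Fin.sum_univ_three, h00, h00', h10, h20, h21, h10', h20', h21', hH 1 0, hH 2 0,
    hH 2 1] at e00 e01 e02 e10 e11 e12 e20 e21 e22 hdet
  have z22 : R 0 1 0 1 = 0 := mul_left_cancel₀ hdet (by linear_combination e22)
  have z21 : R 0 1 0 2 = 0 := mul_left_cancel₀ hdet (by linear_combination - e21)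
  have z20 : R 0 1 1 2 = 0 := mul_left_cancel₀ hdet (by linear_combination e20)
  have z12 : R 0 2 0 1 = 0 := mul_left_cancel₀ hdet (by linear_combination - e12)
  have z11 : R 0 2 0 2 = 0 := mul_left_cancel₀ hdet (by linear_combination e11)
  have z10 : R 0 2 1 2 = 0 := mul_left_cancel₀ hdet (by linear_combination - e10)
  have z02 : R 1 2 0 1 = 0 := mul_left_cancel₀ hdet (by linear_combination e02)
  have z01 : R 1 2 0 2 = 0 := mul_left_cancel₀ hdet (by linear_combination - e01)
  have z00 : R 1 2 1 2 = 0 := mul_left_cancel₀ hdet (by linear_combination e00)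
  fin_cases k <;> fin_cases a <;> fin_cases b <;> fin_cases c <;>
    simp [h00, h00', h10, h20, h21, h10', h20', h21', z22, z21, z20, z12, z11, z10, z02, z01, z00]

lemma pd_add {f h : V3 → ℝ} (hf : Differentiable ℝ f) (hh : Differentiable ℝ h) (i : Fin 3)
    (x : V3) : pd i (fun y => f y + h y) x = pd i f x + pd i h x := by
  simp [pd, fderiv_fun_add (hf x) (hh x)]

lemma pd_mul {f h : V3 → ℝ} (hf : Differentiable ℝ f) (hh : Differentiable ℝ h) (i : Fin 3)
    (x : V3) : pd i (fun y => f y * h y) x = pd i f x * h x + f x * pd i h x := by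
  simp [pd, fderiv_fun_mul (hf x) (hh x)]
  ring

lemma pd_sum {κ : Type*} [Fintype κ] {f : κ → V3 → ℝ} (hf : ∀ k, Differentiable ℝ (f k))
    (i : Fin 3) (x : V3) : pd i (fun y => ∑ k, f k y) x = ∑ k, pd i (f k) x := by
  simp [pd, fderiv_fun_sum fun k _ => hf k x]

@[simp]
lemma pd_const (i : Fin 3) (x : V3) (c : ℝ) : pd i (fun _ => c) x = 0 := by
  simp [pd]

lemma contDiff_pd {f : V3 → ℝ} (hf : ContDiff ℝ ∞ f) (i : Fin 3) : ContDiff ℝ ∞ (pd i f) :=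
  (hf.fderiv_right (by simp)).clm_apply contDiff_const

lemma pd_comm {f : V3 → ℝ} (hf : ContDiff ℝ ∞ f) (i j : Fin 3) (x : V3) :
    pd i (pd j f) x = pd j (pd i f) x := by
  have h : ∀ i j : Fin 3, pd i (pd j f) x =
      fderiv ℝ (fderiv ℝ f) x (EuclideanSpace.single i 1) (EuclideanSpace.single j 1) := by
    intro i j
    have h1 : HasFDerivAt (fderiv ℝ f) (fderiv ℝ (fderiv ℝ f) x) x :=
      ((hf.fderiv_right (m := ∞) (by simp)).differentiable (by simp) x).hasFDerivAt
    have h2 := h1.clm_apply (hasFDerivAt_const (EuclideanSpace.single j (1 : ℝ)) x)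
    change fderiv ℝ (fun y => fderiv ℝ f y (EuclideanSpace.single j 1)) x _ = _
    rw [h2.fderiv]
    simp
  rw [h, h]
  exact (hf.contDiffAt.isSymmSndFDerivAt (by
      rw [minSmoothness_of_isRCLikeNormedField]
      exact WithTop.coe_le_coe.2 (le_top : (2 : ℕ∞) ≤ ⊤))) _ _

section Metric

variable {g ginv : V3 → Fin 3 → Fin 3 → ℝ}

lemma Γc_symm (hgsym : ∀ x i j, g x i j = g x j i) (l i j : Fin 3) (x : V3) :
    Γc g ginv l i j x = Γc g ginv l j i x := by
  have h : (fun y => g y i j) = fun y => g y j i := funext fun y => hgsym y i j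
  have h' : ∀ m, (fun y => g y m j) = fun y => g y j m := fun m => funext fun y => hgsym y m j
  simp only [Γc, h, add_comm]

lemma contDiff_Γc (hgC : ∀ i j, ContDiff ℝ ∞ (fun x => g x i j))
    (hginvC : ∀ i j, ContDiff ℝ ∞ (fun x => ginv x i j)) (l i j : Fin 3) :
    ContDiff ℝ ∞ (Γc g ginv l i j) :=
  contDiff_const.mul (ContDiff.sum fun m _ => (hginvC l m).mul
    (((contDiff_pd (hgC _ _) _).add (contDiff_pd (hgC _ _) _)).sub (contDiff_pd (hgC _ _) _)))

lemma sum_mul_Γc (hinv : ∀ x i j, ∑ l, g x i l * ginv x l j = if i = j then (1 : ℝ) else 0)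
    (k i j : Fin 3) (x : V3) : ∑ l, g x k l * Γc g ginv l i j x =
      (1 / 2) * (pd i (fun y => g y k j) x + pd j (fun y => g y k i) x
        - pd k (fun y => g y i j) x) := by
  have h : ∀ D : Fin 3 → ℝ, ∑ l, g x k l * ((1 / 2) * ∑ m, ginv x l m * D m) = (1 / 2) * D k := by
    intro D
    calc _ = ∑ m, (1 / 2) * ((∑ l, g x k l * ginv x l m) * D m) := by
          simp only [Finset.mul_sum, Finset.sum_mul]
          rw [Finset.sum_comm]
          exact Finset.sum_congr rfl fun _ _ => Finset.sum_congr rfl fun _ _ => by ring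
      _ = _ := by simp [hinv]
  exact h _

/-- The Levi-Civita connection is metric. -/
lemma pd_metric (hgsym : ∀ x i j, g x i j = g x j i)
    (hinv : ∀ x i j, ∑ l, g x i l * ginv x l j = if i = j then (1 : ℝ) else 0)
    (c i j : Fin 3) (x : V3) : pd c (fun y => g y i j) x =
      ∑ m, (g x i m * Γc g ginv m c j x + g x j m * Γc g ginv m c i x) := by
  have h : ∀ i j, (fun y => g y i j) = fun y => g y j i := fun i j => funext fun y => hgsym y i j
  rw [Finset.sum_add_distrib, sum_mul_Γc hinv, sum_mul_Γc hinv, h j i, h c i, h c j]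
  ring

/-- The curvature tensor of the Levi-Civita connection is antisymmetric in the first pair. -/
lemma sum_mul_Riem_antisymm (hgC : ∀ i j, ContDiff ℝ ∞ (fun x => g x i j))
    (hginvC : ∀ i j, ContDiff ℝ ∞ (fun x => ginv x i j)) (hgsym : ∀ x i j, g x i j = g x j i)
    (hinv : ∀ x i j, ∑ l, g x i l * ginv x l j = if i = j then (1 : ℝ) else 0)
    (k a b c : Fin 3) (x : V3) : ∑ l, g x k l * Riem g ginv l a b c x =
      - ∑ l, g x a l * Riem g ginv l k b c x := by
  have hg : ∀ i j, Differentiable ℝ (fun x => g x i j) := fun i j =>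
    (hgC i j).differentiable (by simp)
  have hΓ : ∀ l i j, Differentiable ℝ (Γc g ginv l i j) := fun l i j =>
    (contDiff_Γc hgC hginvC l i j).differentiable (by simp)
  have h1 : ∀ b c, pd b (pd c (fun y => g y k a)) x = ∑ m,
      (pd b (fun y => g y k m) x * Γc g ginv m c a x + g x k m * pd b (Γc g ginv m c a) x +
        (pd b (fun y => g y a m) x * Γc g ginv m c k x + g x a m * pd b (Γc g ginv m c k) x)) := by
    intro b c
    rw [show pd c (fun y => g y k a) = _ from funext fun y => pd_metric hgsym hinv c k a y]
    refine (pd_sum (f := fun m y => g y k m * Γc g ginv m c a y + g y a m * Γc g ginv m c k y)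
      (fun m => ((hg _ _).mul (hΓ _ _ _)).add ((hg _ _).mul (hΓ _ _ _))) b x).trans ?_
    refine Finset.sum_congr rfl fun m _ => ?_
    refine (pd_add ((hg _ _).mul (hΓ _ _ _)) ((hg _ _).mul (hΓ _ _ _)) b x).trans ?_
    simp only [Pi.mul_def]
    rw [pd_mul (hg _ _) (hΓ _ _ _),
      pd_mul (hg _ _) (hΓ _ _ _)]
  have h2 := pd_comm (hgC k a) b c x
  have hs : ∀ l i, Γc g ginv l i a = Γc g ginv l a i ∧ Γc g ginv l i k = Γc g ginv l k i :=
    fun l i => ⟨funext fun y => Γc_symm hgsym l i a y, funext fun y => Γc_symm hgsym l i k y⟩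
  rw [h1, h1] at h2
  simp only [pd_metric hgsym hinv] at h2
  simp only [Riem]
  simp only [Fin.sum_univ_three, fun l i => (hs l i).1, fun l i => (hs l i).2, hgsym x 1 0,
    hgsym x 2 0, hgsym x 2 1] at h2 ⊢
  linear_combination h2

/-- Ricci-flat metrics in dimension three are flat. -/
lemma Riem_eq_zero (hgC : ∀ i j, ContDiff ℝ ∞ (fun x => g x i j))
    (hginvC : ∀ i j, ContDiff ℝ ∞ (fun x => ginv x i j)) (hgsym : ∀ x i j, g x i j = g x j i)
    (hinv : ∀ x i j, ∑ l, g x i l * ginv x l j = if i = j then (1 : ℝ) else 0) {x : V3}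
    (hRic : ∀ a b, Ricci g ginv a b x = 0) (l a b c : Fin 3) : Riem g ginv l a b c x = 0 := by
  have hGH : Matrix.of (g x) * Matrix.of (ginv x) = 1 := by
    ext i j
    simpa [Matrix.mul_apply, Matrix.one_apply] using hinv x i j
  have hHG := mul_eq_one_comm.1 hGH
  have hHG' : ∀ i j, ∑ l, ginv x i l * g x l j = if i = j then (1 : ℝ) else 0 := fun i j => by
    simpa [Matrix.mul_apply, Matrix.one_apply] using congrFun (congrFun hHG i) j
  have hH : ∀ i j, ginv x i j = ginv x j i := by
    have hG : (Matrix.of (g x)).transpose = Matrix.of (g x) := by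
      ext i j
      exact hgsym x j i
    have h1 := congrArg Matrix.transpose hGH
    rw [Matrix.transpose_mul, hG, Matrix.transpose_one] at h1
    have h2 := left_inv_eq_right_inv h1 hGH
    exact fun i j => (congrFun (congrFun h2 j) i)
  have hraise : ∀ (D : Fin 3 → ℝ) (l : Fin 3), ∑ k, ginv x l k * ∑ m, g x k m * D m = D l := by
    intro D l
    calc _ = ∑ m, (∑ k, ginv x l k * g x k m) * D m := by
          simp only [Finset.mul_sum, Finset.sum_mul]
          rw [Finset.sum_comm]
          exact Finset.sum_congr rfl fun _ _ => Finset.sum_congr rfl fun _ _ => by ring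
      _ = D l := by simp [hHG']
  have hR := eq_zero_of_antisymm_of_contraction_eq_zero hH
    (Matrix.det_ne_zero_of_left_inverse hGH)
    (R := fun k a b c => ∑ l, g x k l * Riem g ginv l a b c x)
    (fun k a b c => sum_mul_Riem_antisymm hgC hginvC hgsym hinv k a b c x)
    (fun k a b c => by
      rw [← Finset.sum_neg_distrib]
      refine Finset.sum_congr rfl fun l _ => ?_
      simp only [Riem, Finset.sum_sub_distrib]
      ring)
    (fun a b => by
      simp only [hraise]
      exact hRic a b)
  rw [← hraise (fun l => Riem g ginv l a b c x) l]
  simp [hR]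

/-- Entrywise partial derivative of a matrix-valued function. -/
noncomputable def pdMatrix (c : Fin 3) (A : V3 → Matrix (Fin 3) (Fin 3) ℝ) (x : V3) :
    Matrix (Fin 3) (Fin 3) ℝ := Matrix.of fun i j => pd c (fun y => A y i j) x

lemma pdMatrix_mul {A B : V3 → Matrix (Fin 3) (Fin 3) ℝ}
    (hA : ∀ i j, Differentiable ℝ fun x => A x i j) (hB : ∀ i j, Differentiable ℝ fun x => B x i j)
    (c : Fin 3) (x : V3) :
    pdMatrix c (fun y => A y * B y) x = pdMatrix c A x * B x + A x * pdMatrix c B x := by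
  ext i j
  simp only [pdMatrix, Matrix.mul_apply, Matrix.of_apply, Matrix.add_apply,
    ← Finset.sum_add_distrib]
  refine (pd_sum (f := fun k y => A y i k * B y k j) (fun k => (hA i k).mul (hB k j)) c x).trans ?_
  exact Finset.sum_congr rfl fun k _ => pd_mul (hA i k) (hB k j) c x

lemma exists_matrix_mul_transpose_eq {A : Matrix (Fin 3) (Fin 3) ℝ} (hA : ∀ i j, A i j = A j i)
    (hpos : ∀ ξ : Fin 3 → ℝ, ξ ≠ 0 → 0 < ∑ i, ∑ j, A i j * ξ i * ξ j) :
    ∃ P : Matrix (Fin 3) (Fin 3) ℝ, P * P.transpose = A := by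
  open scoped MatrixOrder Matrix.Norms.L2Operator in
  have h : A.PosSemidef := by
    refine Matrix.PosSemidef.of_dotProduct_mulVec_nonneg (Matrix.IsHermitian.ext fun i j => ?_) ?_
    · simpa using hA j i
    · intro ξ
      by_cases h0 : ξ = 0
      · simp [h0]
      · refine (hpos ξ h0).le.trans_eq ?_
        simp only [dotProduct, Matrix.mulVec, Finset.mul_sum, Pi.star_apply, star_trivial]
        exact Finset.sum_congr rfl fun _ _ => Finset.sum_congr rfl fun _ _ => by ring
  obtain ⟨B, rfl⟩ := CStarAlgebra.nonneg_iff_eq_mul_star_self.1 h.nonneg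
  exact ⟨B, by rw [Matrix.star_eq_conjTranspose, Matrix.conjTranspose_eq_transpose_of_trivial]⟩

lemma eq_of_pd_eq_zero {f : V3 → ℝ} (hf : Differentiable ℝ f)
    (h : ∀ x ∈ Metric.closedBall (0 : V3) 1, ∀ c, pd c f x = 0) :
    ∀ x ∈ Metric.closedBall (0 : V3) 1, f x = f 0 := by
  intro x hx
  have h1 := (convex_closedBall (0 : V3) 1).norm_image_sub_le_of_norm_fderiv_le (f := f) (𝕜 := ℝ)
    (C := 0) (fun y _ => hf y) (fun y hy => by
      refine le_of_eq (norm_eq_zero.2 ?_)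
      ext v
      simp [fderiv_eq_sum_pd, h y hy]) (Metric.mem_closedBall_self zero_le_one) hx
  simpa [sub_eq_zero] using h1

/-- Coefficients of the flat connection whose parallel sections are pairs `(f, df)` with `f` an
affine function of the metric. -/
noncomputable def affineConn (g ginv : V3 → Fin 3 → Fin 3 → ℝ) (i : Fin 3) :
    Option (Fin 3) → Option (Fin 3) → V3 → ℝ
  | none, none => fun _ => 0
  | none, some k => fun _ => if i = k then 1 else 0
  | some _, none => fun _ => 0
  | some j, some k => Γc g ginv k i j

lemma exists_affine_coords (hgC : ∀ i j, ContDiff ℝ ∞ (fun x => g x i j))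
    (hginvC : ∀ i j, ContDiff ℝ ∞ (fun x => ginv x i j)) (hgsym : ∀ x i j, g x i j = g x j i)
    (hinv : ∀ x i j, ∑ l, g x i l * ginv x l j = if i = j then (1 : ℝ) else 0)
    (hRic : ∀ x ∈ Metric.closedBall (0 : V3) 1, ∀ a b, Ricci g ginv a b x = 0)
    (w₀ : Fin 3 → ℝ) :
    ∃ (f : V3 → ℝ) (w : Fin 3 → V3 → ℝ), ContDiff ℝ ∞ f ∧ (∀ j, ContDiff ℝ ∞ (w j)) ∧
      (∀ j, w j 0 = w₀ j) ∧ ∀ x ∈ Metric.closedBall (0 : V3) 1,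
        (∀ j, pd j f x = w j x) ∧ ∀ c j, pd c (w j) x = ∑ k, Γc g ginv k c j x * w k x := by
  obtain ⟨u, hu, hu0, hdu⟩ := exists_contDiff_parallel_coords (a := affineConn g ginv)
    (by
      rintro i (_ | j) (_ | k)
      · exact contDiff_const
      · exact contDiff_const
      · exact contDiff_const
      · exact contDiff_Γc hgC hginvC _ _ _)
    (by
      rintro x hx i j (_ | l) (_ | m)
      · simp [Fintype.sum_option, affineConn]
      · simp [Fintype.sum_option, affineConn, Γc_symm hgsym m i j x]
      · simp [Fintype.sum_option, affineConn]
      · have h := Riem_eq_zero hgC hginvC hgsym hinv (hRic x hx) m l i j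
        have hs : ∀ k i, Γc g ginv k l i = Γc g ginv k i l := fun k i =>
          funext fun y => Γc_symm hgsym k l i y
        simp only [Riem, hs, Finset.sum_sub_distrib] at h
        simp only [Fintype.sum_option, affineConn, mul_comm (Γc g ginv _ _ l x)]
        linarith)
    (fun α => α.elim 0 w₀)
  refine ⟨u none, fun j => u (some j), hu _, fun j => hu _, fun j => by simp [hu0],
    fun x hx => ⟨fun j => ?_, fun c j => ?_⟩⟩
  · rw [hdu x hx, Fintype.sum_option]
    simp [affineConn]
  · rw [hdu x hx, Fintype.sum_option]
    simp [affineConn]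

/-- A Ricci-flat metric on the ball is the pull-back of the Euclidean one under a smooth map. -/
lemma exists_isometric_immersion (hgC : ∀ i j, ContDiff ℝ ∞ (fun x => g x i j))
    (hginvC : ∀ i j, ContDiff ℝ ∞ (fun x => ginv x i j)) (hgsym : ∀ x i j, g x i j = g x j i)
    (hinv : ∀ x i j, ∑ l, g x i l * ginv x l j = if i = j then (1 : ℝ) else 0)
    (hpos : ∀ ξ : Fin 3 → ℝ, ξ ≠ 0 → 0 < ∑ i, ∑ j, g 0 i j * ξ i * ξ j)
    (hRic : ∀ x ∈ Metric.closedBall (0 : V3) 1, ∀ a b, Ricci g ginv a b x = 0) :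
    ∃ (F : Fin 3 → V3 → ℝ) (w : Fin 3 → Fin 3 → V3 → ℝ), (∀ a, ContDiff ℝ ∞ (F a)) ∧
      (∀ j a, ContDiff ℝ ∞ (w j a)) ∧ ∀ x ∈ Metric.closedBall (0 : V3) 1,
        (∀ j a, pd j (F a) x = w j a x) ∧
        (∀ c j a, pd c (w j a) x = ∑ k, Γc g ginv k c j x * w k a x) ∧
        ∀ i j, ∑ a, w i a x * w j a x = g x i j := by
  obtain ⟨P, hP⟩ := exists_matrix_mul_transpose_eq (A := Matrix.of (g 0)) (hgsym 0) hpos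
  choose F w hF hw hw0 hdw using fun a : Fin 3 =>
    exists_affine_coords hgC hginvC hgsym hinv hRic fun j => P j a
  refine ⟨F, fun j a => w a j, hF, fun j a => hw a j, fun x hx =>
    ⟨fun j a => (hdw a x hx).1 j, fun c j a => (hdw a x hx).2 c j, ?_⟩⟩
  let G : V3 → Matrix (Fin 3) (Fin 3) ℝ := fun x => Matrix.of (g x)
  let H : V3 → Matrix (Fin 3) (Fin 3) ℝ := fun x => Matrix.of (ginv x)
  let Wm : V3 → Matrix (Fin 3) (Fin 3) ℝ := fun x => Matrix.of fun i a => w a i x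
  let Wt : V3 → Matrix (Fin 3) (Fin 3) ℝ := fun x => (Wm x).transpose
  let Γm : Fin 3 → V3 → Matrix (Fin 3) (Fin 3) ℝ := fun c x =>
    Matrix.of fun k j => Γc g ginv k c j x
  have hGH : ∀ x, G x * H x = 1 := fun x => by
    ext i j
    simpa [G, H, Matrix.mul_apply, Matrix.one_apply] using hinv x i j
  have hHG : ∀ x, H x * G x = 1 := fun x => mul_eq_one_comm.1 (hGH x)
  have hGd : ∀ i j, Differentiable ℝ fun x => G x i j := fun i j =>
    (hgC i j).differentiable (by simp)
  have hHd : ∀ i j, Differentiable ℝ fun x => H x i j := fun i j =>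
    (hginvC i j).differentiable (by simp)
  have hWd : ∀ i j, Differentiable ℝ fun x => Wm x i j := fun i j =>
    (hw j i).differentiable (by simp)
  have hWtd : ∀ i j, Differentiable ℝ fun x => Wt x i j := fun i j => hWd j i
  have hdG : ∀ c x, pdMatrix c G x = G x * Γm c x + (Γm c x).transpose * G x := by
    intro c x
    ext i j
    simp only [pdMatrix, Matrix.of_apply, Matrix.add_apply, Matrix.mul_apply,
      Matrix.transpose_apply, G, Γm, pd_metric hgsym hinv, Finset.sum_add_distrib]
    congr 1
    exact Finset.sum_congr rfl fun m _ => by rw [hgsym x j m, mul_comm]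
  have hdH : ∀ c x, pdMatrix c H x = - (Γm c x * H x) - H x * (Γm c x).transpose := by
    intro c x
    have h1 := pdMatrix_mul hGd hHd c x
    have h2 : pdMatrix c (fun y => G y * H y) x = 0 := by
      ext i j
      simp [pdMatrix, hGH]
    rw [h2, hdG] at h1
    have h3 := congrArg (fun M => H x * M) h1.symm
    simp only [mul_add, ← mul_assoc, hHG, add_mul, one_mul, mul_zero] at h3
    rw [mul_assoc (H x * _), hGH, mul_one] at h3
    rw [eq_sub_iff_add_eq, eq_neg_iff_add_eq_zero, ← h3]
    abel
  have hdW : ∀ c, ∀ x ∈ Metric.closedBall (0 : V3) 1,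
      pdMatrix c Wm x = (Γm c x).transpose * Wm x := by
    intro c x hx
    ext i a
    simp only [pdMatrix, Matrix.of_apply, Wm, Γm, Matrix.mul_apply, Matrix.transpose_apply]
    exact (hdw a x hx).2 c i
  have hdWt : ∀ c, ∀ x ∈ Metric.closedBall (0 : V3) 1, pdMatrix c Wt x = Wt x * Γm c x := by
    intro c x hx
    rw [show pdMatrix c Wt x = (pdMatrix c Wm x).transpose from rfl, hdW c x hx,
      Matrix.transpose_mul, Matrix.transpose_transpose]
  have hHW : ∀ i j, Differentiable ℝ fun x => (H x * Wm x) i j := fun i j => by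
    simp only [Matrix.mul_apply]
    exact Differentiable.fun_sum fun k _ => (hHd i k).mul (hWd k j)
  have hdM : ∀ c, ∀ x ∈ Metric.closedBall (0 : V3) 1,
      pdMatrix c (fun y => Wt y * (H y * Wm y)) x = 0 := by
    intro c x hx
    rw [pdMatrix_mul hWtd hHW, pdMatrix_mul hHd hWd, hdWt c x hx, hdH, hdW c x hx]
    noncomm_ring
  have hM0 : Wt 0 * (H 0 * Wm 0) = 1 := by
    have h0 : Wm 0 = P := by
      ext i a
      exact hw0 a i
    rw [show Wt 0 = (Wm 0).transpose from rfl, h0, mul_eq_one_comm, mul_assoc, hP]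
    exact hHG 0
  have hM : Wt x * (H x * Wm x) = 1 := by
    rw [← hM0]
    ext i j
    refine eq_of_pd_eq_zero (f := fun y => (Wt y * (H y * Wm y)) i j) ?_ (fun y hy c => ?_) x hx
    · simp only [Matrix.mul_apply (M := Wt _)]
      exact Differentiable.fun_sum fun k _ => (hWtd i k).mul (hHW k j)
    · exact congrFun (congrFun (hdM c y hy) i) j
  have hfin : Wm x * Wt x = G x := by
    rw [mul_eq_one_comm, mul_assoc] at hM
    calc Wm x * Wt x = G x * (H x * (Wm x * Wt x)) := by rw [← mul_assoc, hGH, one_mul]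
      _ = G x := by rw [hM, mul_one]
  intro i j
  exact congrFun (congrFun hfin i) j

end Metric

lemma fderiv_eq_zero_of_eqOn_sphere {E : Type*} [NormedAddCommGroup E] [InnerProductSpace ℝ E]
    {f : E → ℝ} {C : ℝ} (hC : ∀ y ∈ Metric.sphere (0 : E) 1, f y = C) {x : E}
    (hf : DifferentiableAt ℝ f x) (hx : x ∈ Metric.sphere (0 : E) 1) {v : E}
    (hv : inner ℝ v x = 0) : fderiv ℝ f x v = 0 := by
  rcases eq_or_ne v 0 with rfl | hv0
  · simp
  have hvn : ‖v‖ ≠ 0 := norm_ne_zero_iff.2 hv0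
  set e : E := ‖v‖⁻¹ • v with he
  have hen : ‖e‖ = 1 := by simp [he, norm_smul, hvn]
  have hxn : ‖x‖ = 1 := by simpa using hx
  have hxe : inner ℝ x e = 0 := by
    rw [he, inner_smul_right, real_inner_comm, hv, mul_zero]
  have hγ : HasDerivAt (fun t : ℝ => Real.cos t • x + Real.sin t • e) e 0 := by
    simpa using ((Real.hasDerivAt_cos 0).smul_const x).fun_add
      ((Real.hasDerivAt_sin 0).smul_const e)
  have hfx : HasFDerivAt f (fderiv ℝ f x) (Real.cos 0 • x + Real.sin 0 • e) := by
    simpa using hf.hasFDerivAt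
  have h1 := hfx.comp_hasDerivAt (0 : ℝ) hγ
  have h2 : (f ∘ fun t : ℝ => Real.cos t • x + Real.sin t • e) = fun _ => C := by
    funext t
    refine hC _ ?_
    rw [mem_sphere_zero_iff_norm, ← sq_eq_sq₀ (norm_nonneg _) zero_le_one, norm_add_sq_real]
    simp [norm_smul, inner_smul_left, inner_smul_right, hxe, hen, hxn]
  rw [h2] at h1
  have h3 : fderiv ℝ f x e = 0 := h1.unique (hasDerivAt_const _ _)
  rw [he, map_smul, smul_eq_mul] at h3
  exact (mul_eq_zero.1 h3).resolve_left (inv_ne_zero hvn)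

lemma eqOn_sphere_of_fderiv_eq_zero {E : Type*} [NormedAddCommGroup E] [InnerProductSpace ℝ E]
    (hE : 1 < Module.rank ℝ E) {f : E → ℝ} (hf : Differentiable ℝ f)
    (h : ∀ x ∈ Metric.sphere (0 : E) 1, ∀ v, inner ℝ v x = 0 → fderiv ℝ f x v = 0)
    {x y : E} (hx : x ∈ Metric.sphere (0 : E) 1) (hy : y ∈ Metric.sphere (0 : E) 1) :
    f x = f y := by
  have hx0 : x ≠ 0 := by rintro rfl; simp at hx
  have hy0 : y ≠ 0 := by rintro rfl; simp at hy
  have hP : ∀ z : E, z ≠ 0 → DifferentiableAt ℝ (fun z : E => ‖z‖⁻¹ • z) z := fun z hz =>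
    ((differentiableAt_id.norm ℝ hz).inv (norm_ne_zero_iff.2 hz)).smul differentiableAt_id
  have hPn : ∀ z : E, z ≠ 0 → ‖‖z‖⁻¹ • z‖ = 1 := fun z hz => by
    simp [norm_smul, norm_ne_zero_iff.2 hz]
  have h1 := isOpen_compl_singleton.is_const_of_fderiv_eq_zero (𝕜 := ℝ)
    (f := fun z : E => f (‖z‖⁻¹ • z))
    (isConnected_compl_singleton_of_one_lt_rank hE (0 : E)).isPreconnected
    (fun z hz => ((hf _).comp z (hP z hz)).differentiableWithinAt) (fun z hz => by
      have h2 : HasFDerivAt (fun z : E => f (‖z‖⁻¹ • z)) _ z :=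
        (hf _).hasFDerivAt.comp z (hP z hz).hasFDerivAt
      ext v
      rw [h2.fderiv]
      refine h _ (by simpa using hPn z hz) _ ?_
      have h3 := (hP z hz).hasFDerivAt.inner ℝ (hP z hz).hasFDerivAt
      have h4 : (fun z : E => inner ℝ (‖z‖⁻¹ • z) (‖z‖⁻¹ • z)) =ᶠ[𝓝 z] fun _ => (1 : ℝ) := by
        filter_upwards [isOpen_compl_singleton.mem_nhds hz] with z hz
        rw [real_inner_self_eq_norm_sq, hPn z hz, one_pow]
      have h5 := congrArg (fun L : E →L[ℝ] ℝ => L v)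
        (h3.unique ((hasFDerivAt_const (1 : ℝ) z).congr_of_eventuallyEq h4))
      simp only [ContinuousLinearMap.comp_apply, ContinuousLinearMap.prod_apply,
        fderivInnerCLM_apply,
        zero_apply] at h5
      rw [real_inner_comm] at h5
      change inner ℝ (fderiv ℝ (fun z => ‖z‖⁻¹ • z) z v) _ = 0
      linarith) (x := x) (y := y) hx0 hy0
  simpa [mem_sphere_zero_iff_norm.1 hx, mem_sphere_zero_iff_norm.1 hy] using h1

section Boundary

variable {g ginv : V3 → Fin 3 → Fin 3 → ℝ} {Nv : V3 → Fin 3 → ℝ}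

lemma inner_eq_sum (v x : V3) : inner ℝ v x = ∑ i, v i * x i := by
  simp [PiLp.inner_apply, mul_comm]

lemma pd_metric_quadratic (hgC : ∀ i j, ContDiff ℝ ∞ (fun x => g x i j))
    (hNC : ∀ i, ContDiff ℝ ∞ (fun x => Nv x i)) (hgsym : ∀ x i j, g x i j = g x j i)
    (hinv : ∀ x i j, ∑ l, g x i l * ginv x l j = if i = j then (1 : ℝ) else 0)
    (c : Fin 3) (x : V3) :
    pd c (fun y => ∑ i, ∑ j, g y i j * Nv y i * Nv y j) x =
      2 * ∑ i, ∑ j, g x i j *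
        (pd c (fun y => Nv y i) x + ∑ l, Γc g ginv i c l x * Nv x l) * Nv x j := by
  have hNd : ∀ i, Differentiable ℝ fun x => Nv x i := fun i => (hNC i).differentiable (by simp)
  have hgd : ∀ i j, Differentiable ℝ fun x => g x i j := fun i j =>
    (hgC i j).differentiable (by simp)
  have h1 : ∀ i j, pd c (fun y => g y i j * Nv y i * Nv y j) x =
      (∑ m, (g x i m * Γc g ginv m c j x + g x j m * Γc g ginv m c i x)) * Nv x i * Nv x j
      + g x i j * pd c (fun y => Nv y i) x * Nv x j
      + g x i j * Nv x i * pd c (fun y => Nv y j) x := fun i j => by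
    rw [← pd_metric hgsym hinv]
    have e1 : HasFDerivAt (fun y => g y i j * Nv y i * Nv y j) _ x :=
      (((hgd i j) x).hasFDerivAt.mul (hNd i x).hasFDerivAt).mul (hNd j x).hasFDerivAt
    simp only [pd, e1.fderiv]
    simp
    ring
  have h2 : pd c (fun y => ∑ i, ∑ j, g y i j * Nv y i * Nv y j) x =
      ∑ i, ∑ j, pd c (fun y => g y i j * Nv y i * Nv y j) x := by
    have e1 : HasFDerivAt (fun y => ∑ i, ∑ j, g y i j * Nv y i * Nv y j)
        (∑ i, ∑ j, fderiv ℝ (fun y => g y i j * Nv y i * Nv y j) x) x :=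
      HasFDerivAt.fun_sum fun i _ => HasFDerivAt.fun_sum fun j _ =>
        DifferentiableAt.hasFDerivAt (by fun_prop)
    simp only [pd, e1.fderiv]
    simp
  have g10 := hgsym x 1 0
  have g20 := hgsym x 2 0
  have g21 := hgsym x 2 1
  rw [h2]
  simp only [h1, Fin.sum_univ_three]
  rw [g10, g20, g21]
  ring

/-- If the second fundamental form of the unit sphere equals the induced metric, then the unit
normal has the covariant derivative of the position vector field. -/
lemma cov_normal_eq (hgC : ∀ i j, ContDiff ℝ ∞ (fun x => g x i j))
    (hNC : ∀ i, ContDiff ℝ ∞ (fun x => Nv x i)) (hgsym : ∀ x i j, g x i j = g x j i)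
    (hinv : ∀ x i j, ∑ l, g x i l * ginv x l j = if i = j then (1 : ℝ) else 0)
    (hpos : ∀ x ∈ Metric.closedBall (0 : V3) 1, ∀ ξ : Fin 3 → ℝ, ξ ≠ 0 →
      0 < ∑ i, ∑ j, g x i j * ξ i * ξ j)
    (hNunit : ∀ x ∈ Metric.sphere (0 : V3) 1, ∑ i, ∑ j, g x i j * Nv x i * Nv x j = 1)
    (hNtang : ∀ x ∈ Metric.sphere (0 : V3) 1, ∀ v : Fin 3 → ℝ,
      (∑ i, v i * x i) = 0 → ∑ i, ∑ j, g x i j * Nv x i * v j = 0)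
    (hNout : ∀ x ∈ Metric.sphere (0 : V3) 1, 0 < ∑ i, Nv x i * x i)
    (hΘ : ∀ x ∈ Metric.sphere (0 : V3) 1, ∀ v w : Fin 3 → ℝ,
      (∑ i, v i * x i) = 0 → (∑ i, w i * x i) = 0 →
      (∑ i, ∑ j, g x i j *
        (∑ c, v c * (pd c (fun y => Nv y i) x + ∑ l, Γc g ginv i c l x * Nv x l)) * w j)
      = ∑ i, ∑ j, g x i j * v i * w j)
    {x : V3} (hx : x ∈ Metric.sphere (0 : V3) 1) {v : V3} (hv : inner ℝ v x = 0) (i : Fin 3) :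
    ∑ c, v c * (pd c (fun y => Nv y i) x + ∑ l, Γc g ginv i c l x * Nv x l) = v i := by
  have hNd : ∀ i, Differentiable ℝ fun x => Nv x i := fun i => (hNC i).differentiable (by simp)
  have hgd : ∀ i j, Differentiable ℝ fun x => g x i j := fun i j =>
    (hgC i j).differentiable (by simp)
  rw [inner_eq_sum] at hv
  set V : Fin 3 → ℝ := fun i =>
    ∑ c, v c * (pd c (fun y => Nv y i) x + ∑ l, Γc g ginv i c l x * Nv x l) with hV
  have hVN : ∑ i, ∑ j, g x i j * V i * Nv x j = 0 := by
    have h1 := fderiv_eq_zero_of_eqOn_sphere hNunit (x := x)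
      (by fun_prop) hx (v := v) (by rw [inner_eq_sum, hv])
    rw [fderiv_eq_sum_pd] at h1
    simp only [pd_metric_quadratic hgC hNC hgsym hinv] at h1
    simp only [hV]
    have h2 : ∀ i, ∑ j, g x i j * (∑ c, v c * (pd c (fun y => Nv y i) x +
        ∑ l, Γc g ginv i c l x * Nv x l)) * Nv x j = ∑ c, v c * ∑ j, g x i j *
        (pd c (fun y => Nv y i) x + ∑ l, Γc g ginv i c l x * Nv x l) * Nv x j := fun i => by
      simp only [Finset.mul_sum, Finset.sum_mul]
      rw [Finset.sum_comm]
      refine Finset.sum_congr rfl fun c _ => Finset.sum_congr rfl fun j _ => ?_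
      ring
    rw [Finset.sum_congr rfl fun i _ => h2 i, Finset.sum_comm]
    simp only [← Finset.mul_sum]
    have h3 : ∑ c, v c * (2 * ∑ i, ∑ j, g x i j * (pd c (fun y => Nv y i) x +
        ∑ l, Γc g ginv i c l x * Nv x l) * Nv x j) = 2 * ∑ c, v c * ∑ i, ∑ j, g x i j *
        (pd c (fun y => Nv y i) x + ∑ l, Γc g ginv i c l x * Nv x l) * Nv x j := by
      rw [Finset.mul_sum]
      exact Finset.sum_congr rfl fun c _ => by ring
    rw [h3] at h1
    linarith
  by_contra hne
  have hpos' := hpos x (Metric.sphere_subset_closedBall hx) (fun k => V k - v k)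
    (fun h0 => hne (by have := congrFun h0 i; simp only [Pi.zero_apply] at this; linarith))
  refine hpos'.ne' ?_
  have hvN := hNtang x hx v hv
  set s : ℝ := ∑ i, Nv x i * x i with hs
  have hs0 : s ≠ 0 := (hNout x hx).ne'
  set α : ℝ := (∑ i, (V i - v i) * x i) / s with hα
  have ht : ∑ i, ((V i - v i) - α * Nv x i) * x i = 0 := by
    have : ∑ i, ((V i - v i) - α * Nv x i) * x i = (∑ i, (V i - v i) * x i) - α * s := by
      rw [hs, Finset.mul_sum, ← Finset.sum_sub_distrib]
      exact Finset.sum_congr rfl fun i _ => by ring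
    rw [this, hα, div_mul_cancel₀ _ hs0, sub_self]
  have h4 := hΘ x hx v (fun i => (V i - v i) - α * Nv x i) hv ht
  change (∑ i, ∑ j, g x i j * V i * _) = _ at h4
  have g10 := hgsym x 1 0
  have g20 := hgsym x 2 0
  have g21 := hgsym x 2 1
  simp only [Fin.sum_univ_three] at h4 hvN hVN ⊢
  rw [g10, g20, g21] at *
  linear_combination h4 + α * hVN - α * hvN

end Boundary

/-- A flat metric on the closed ball whose unit normal along the sphere has the covariant
derivative of the position vector field is developed into Euclidean space so that the
boundary lands on the unit sphere. -/
lemma exists_isometric_immersion_mapsTo_sphere {g ginv : V3 → Fin 3 → Fin 3 → ℝ}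
    {Nv : V3 → Fin 3 → ℝ} {F : Fin 3 → V3 → ℝ} {w : Fin 3 → Fin 3 → V3 → ℝ}
    (hNC : ∀ i, ContDiff ℝ ∞ (fun x => Nv x i))
    (hNunit : ∀ x ∈ Metric.sphere (0 : V3) 1, ∑ i, ∑ j, g x i j * Nv x i * Nv x j = 1)
    (hcov : ∀ x ∈ Metric.sphere (0 : V3) 1, ∀ v : V3, inner ℝ v x = 0 → ∀ i,
      ∑ c, v c * (pd c (fun y => Nv y i) x + ∑ l, Γc g ginv i c l x * Nv x l) = v i)
    (hF : ∀ a, ContDiff ℝ ∞ (F a)) (hw : ∀ j a, ContDiff ℝ ∞ (w j a))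
    (hdF : ∀ x ∈ Metric.closedBall (0 : V3) 1, ∀ j a, pd j (F a) x = w j a x)
    (hdw : ∀ x ∈ Metric.closedBall (0 : V3) 1, ∀ c j a,
      pd c (w j a) x = ∑ k, Γc g ginv k c j x * w k a x)
    (hww : ∀ x ∈ Metric.closedBall (0 : V3) 1, ∀ i j, ∑ a, w i a x * w j a x = g x i j) :
    ∃ Φ : V3 → V3, ContDiff ℝ ∞ Φ ∧ (∀ x ∈ Metric.sphere (0 : V3) 1, ‖Φ x‖ = 1) ∧
      ∀ x ∈ Metric.closedBall (0 : V3) 1, ∀ i j,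
        ∑ a, pd i (fun y => Φ y a) x * pd j (fun y => Φ y a) x = g x i j := by
  have hNd : ∀ i, Differentiable ℝ fun x => Nv x i := fun i => (hNC i).differentiable (by simp)
  have hFd : ∀ a, Differentiable ℝ (F a) := fun a => (hF a).differentiable (by simp)
  have hwd : ∀ j a, Differentiable ℝ (w j a) := fun j a => (hw j a).differentiable (by simp)
  have hD : ∀ a, ∀ x ∈ Metric.sphere (0 : V3) 1, ∀ v : V3, inner ℝ v x = 0 →
      fderiv ℝ (fun y => ∑ i, w i a y * Nv y i - F a y) x v = 0 := by
    intro a x hx v hv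
    have hxb := Metric.sphere_subset_closedBall hx
    have e1 : HasFDerivAt (fun y => ∑ i, w i a y * Nv y i - F a y) _ x :=
      (HasFDerivAt.fun_sum (u := Finset.univ) fun i _ =>
        (hwd i a x).hasFDerivAt.mul (hNd i x).hasFDerivAt).sub (hFd a x).hasFDerivAt
    have h := hcov x hx v hv
    rw [e1.fderiv]
    simp only [_root_.sub_apply, sum_apply, add_apply, smul_apply, smul_eq_mul,
      fderiv_eq_sum_pd, hdF x hxb, hdw x hxb]
    have h1 : ∀ i, w i a x * ∑ c, v c * (pd c (fun y => Nv y i) x +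
      ∑ l, Γc g ginv i c l x * Nv x l) = w i a x * v i := fun i => by rw [h i]
    have h0 := h1 0
    have h1' := h1 1
    have h2 := h1 2
    simp only [Fin.sum_univ_three] at h0 h1' h2 ⊢
    linear_combination h0 + h1' + h2
  have hrank : 1 < Module.rank ℝ V3 := by
    rw [← Module.finrank_eq_rank, finrank_euclideanSpace]
    simp
  obtain ⟨p, hp⟩ : (Metric.sphere (0 : V3) 1).Nonempty := NormedSpace.sphere_nonempty.2 zero_le_one
  set D : Fin 3 → V3 → ℝ := fun a y => ∑ i, w i a y * Nv y i - F a y with hDdef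
  have hDd : ∀ a, Differentiable ℝ (D a) := fun a => by
    simp only [hDdef]
    fun_prop
  have hconst : ∀ a, ∀ x ∈ Metric.sphere (0 : V3) 1, D a x = D a p := fun a x hx =>
    eqOn_sphere_of_fderiv_eq_zero hrank (hDd a) (hD a) hx hp
  refine ⟨fun x => WithLp.toLp 2 fun a => F a x + D a p, ?_, fun x hx => ?_, fun x hx i j => ?_⟩
  · rw [contDiff_euclidean]
    exact fun a => (hF a).add contDiff_const
  · have hxb := Metric.sphere_subset_closedBall hx
    have h1 : ∀ a, F a x + D a p = ∑ i, w i a x * Nv x i := fun a => by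
      rw [← hconst a x hx, hDdef]
      ring
    have h2 : ‖(WithLp.toLp 2 fun a => F a x + D a p : V3)‖ ^ 2 = 1 := by
      rw [EuclideanSpace.real_norm_sq_eq, ← hNunit x hx]
      simp only [h1, ← hww x hxb, Fin.sum_univ_three]
      ring
    exact (pow_eq_one_iff_of_nonneg (norm_nonneg _) two_ne_zero).1 h2
  · rw [← hww x hx]
    refine Finset.sum_congr rfl fun a _ => ?_
    have h1 : ∀ i, pd i (fun y => (WithLp.toLp 2 fun a => F a y + D a p : V3) a) x = w i a x :=
      fun i => by
        refine (pd_add (hFd a) (differentiable_const (D a p)) i x).trans ?_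
        rw [pd_const, add_zero, hdF x hx]
    rw [h1, h1]

/-- A map whose pulled-back Euclidean metric is positive definite at `x` has invertible
differential at `x`. -/
lemma isInvertible_fderiv {g : V3 → Fin 3 → Fin 3 → ℝ} {Φ : V3 → V3} (hΦ : ContDiff ℝ ∞ Φ) {x : V3}
    (hpos : ∀ ξ : Fin 3 → ℝ, ξ ≠ 0 → 0 < ∑ i, ∑ j, g x i j * ξ i * ξ j)
    (hg : ∀ i j, ∑ a, pd i (fun y => Φ y a) x * pd j (fun y => Φ y a) x = g x i j) :
    (fderiv ℝ Φ x).IsInvertible := by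
  have hcomp : ∀ v a, fderiv ℝ (fun y => Φ y a) x v = fderiv ℝ Φ x v a := fun v a => by
    have h := (EuclideanSpace.proj (𝕜 := ℝ) a : V3 →L[ℝ] ℝ).hasFDerivAt.comp x
      (hΦ.differentiable (by simp) x).hasFDerivAt
    exact congrArg (fun L : V3 →L[ℝ] ℝ => L v) h.fderiv
  have hinj : Function.Injective (fderiv ℝ Φ x) := by
    refine (injective_iff_map_eq_zero _).2 fun v hv => ?_
    by_contra hne
    refine (hpos v fun h0 => hne (by ext i; exact congrFun h0 i)).ne' ?_
    have h1 : ∀ a, ∑ i, v i * pd i (fun y => Φ y a) x = 0 := fun a => by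
      rw [← fderiv_eq_sum_pd, hcomp, hv, PiLp.zero_apply]
    have h2 : ∑ i, ∑ j, g x i j * v i * v j =
        ∑ a, (∑ i, v i * pd i (fun y => Φ y a) x) ^ 2 := by
      simp only [← hg, Fin.sum_univ_three]
      ring
    rw [h2]
    simp [h1]
  exact ⟨(LinearEquiv.ofInjectiveEndo (fderiv ℝ Φ x : V3 →ₗ[ℝ] V3) hinj).toContinuousLinearEquiv,
    by ext; rfl⟩

/-- A local right inverse of an isometric immersion into Euclidean space pulls the metric back
to the Euclidean metric. -/
lemma sum_metric_mul_pd_eq {g : V3 → Fin 3 → Fin 3 → ℝ} {Φ φ : V3 → V3} (hΦ : ContDiff ℝ ∞ Φ)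
    (hφ : ContDiff ℝ ∞ φ) {x : V3}
    (hg : ∀ i j, ∑ a, pd i (fun y => Φ y a) (φ x) * pd j (fun y => Φ y a) (φ x) = g (φ x) i j)
    (hinv : Φ ∘ φ =ᶠ[𝓝 x] id) (i j : Fin 3) :
    ∑ p, ∑ q, g (φ x) p q * pd i (fun y => φ y p) x * pd j (fun y => φ y q) x =
      if i = j then 1 else 0 := by
  have hcomp : ∀ v a, fderiv ℝ (fun y => φ y a) x v = fderiv ℝ φ x v a := fun v a => by
    have h := (EuclideanSpace.proj (𝕜 := ℝ) a : V3 →L[ℝ] ℝ).hasFDerivAt.comp x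
      (hφ.differentiable (by simp) x).hasFDerivAt
    exact congrArg (fun L : V3 →L[ℝ] ℝ => L v) h.fderiv
  have h1 : ∀ i a, ∑ p, pd i (fun y => φ y p) x * pd p (fun y => Φ y a) (φ x) =
      if i = a then 1 else 0 := fun i a => by
    have hd : DifferentiableAt ℝ (fun y => Φ y a) (φ x) :=
      ((contDiff_euclidean.1 hΦ a).differentiable (by simp)) _
    have h2 : HasFDerivAt (fun y => Φ (φ y) a) _ x :=
      hd.hasFDerivAt.comp x (hφ.differentiable (by simp) x).hasFDerivAt
    have h3 : (fun y => Φ (φ y) a) =ᶠ[𝓝 x] fun y => y a := by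
      filter_upwards [hinv] with y hy
      exact congrArg (fun z : V3 => z a) hy
    have h4 := (h2.congr_of_eventuallyEq h3.symm).unique
      (EuclideanSpace.proj (𝕜 := ℝ) a : V3 →L[ℝ] ℝ).hasFDerivAt
    have h5 := congrArg (fun L : V3 →L[ℝ] ℝ => L (EuclideanSpace.single i 1)) h4
    simp only [ContinuousLinearMap.comp_apply, fderiv_eq_sum_pd] at h5
    simp only [pd, hcomp] at h5 ⊢
    rw [h5]
    simp [eq_comm]
  have h2 : ∑ p, ∑ q, g (φ x) p q * pd i (fun y => φ y p) x * pd j (fun y => φ y q) x =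
      ∑ a, (∑ p, pd i (fun y => φ y p) x * pd p (fun y => Φ y a) (φ x)) *
        ∑ q, pd j (fun y => φ y q) x * pd q (fun y => Φ y a) (φ x) := by
    simp only [← hg, Fin.sum_univ_three]
    ring
  rw [h2]
  simp [h1]

end

/-- rigidity.  A smooth compact Riemannian 3-manifold `(M,g)`
diffeomorphic to the closed unit ball (global coordinates on `B̄(0,1)`), with `Ric = 0`
on `M` and boundary second fundamental form `Θ` satisfying `tr Θ = 2`, `Θ̂ = 0`
(equivalently `Θ = g̸`, the induced metric on `∂M`), is isometric to the closed unit
Euclidean ball: there is a diffeomorphism of the ball pulling `g` back to the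
Euclidean metric. -/
theorem stmt_12
    (g ginv : V3 → Fin 3 → Fin 3 → ℝ) (Nv : V3 → Fin 3 → ℝ)
    (hgC : ∀ i j, ContDiff ℝ (⊤ : ℕ∞) (fun x => g x i j))
    (hginvC : ∀ i j, ContDiff ℝ (⊤ : ℕ∞) (fun x => ginv x i j))
    (hNC : ∀ i, ContDiff ℝ (⊤ : ℕ∞) (fun x => Nv x i))
    (hgsym : ∀ x i j, g x i j = g x j i)
    (hinv : ∀ x i j, ∑ l, g x i l * ginv x l j = if i = j then (1:ℝ) else 0)
    (hpos : ∀ x ∈ Metric.closedBall (0:V3) 1, ∀ ξ : Fin 3 → ℝ, ξ ≠ 0 →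
      0 < ∑ i, ∑ j, g x i j * ξ i * ξ j)
    -- Ricci flatness on M
    (hRic : ∀ x ∈ Metric.closedBall (0:V3) 1, ∀ a b, Ricci g ginv a b x = 0)
    -- `Nv` is the outward `g`-unit normal along `∂M`
    (hNunit : ∀ x ∈ Metric.sphere (0:V3) 1, ∑ i, ∑ j, g x i j * Nv x i * Nv x j = 1)
    (hNtang : ∀ x ∈ Metric.sphere (0:V3) 1, ∀ v : Fin 3 → ℝ,
      (∑ i, v i * x i) = 0 → ∑ i, ∑ j, g x i j * Nv x i * v j = 0)
    (hNout : ∀ x ∈ Metric.sphere (0:V3) 1, 0 < ∑ i, Nv x i * x i)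
    -- boundary condition `Θ(v,w) = g(∇_v N, w) = g̸(v,w)`, i.e. `tr Θ = 2` and `Θ̂ = 0`
    (hΘ : ∀ x ∈ Metric.sphere (0:V3) 1, ∀ v w : Fin 3 → ℝ,
      (∑ i, v i * x i) = 0 → (∑ i, w i * x i) = 0 →
      (∑ i, ∑ j, g x i j *
        (∑ c, v c * (pd c (fun y => Nv y i) x + ∑ l, Γc g ginv i c l x * Nv x l)) * w j)
      = ∑ i, ∑ j, g x i j * v i * w j) :
    ∃ φ : V3 → V3, ContDiff ℝ (⊤ : ℕ∞) φ ∧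
      Set.BijOn φ (Metric.closedBall (0:V3) 1) (Metric.closedBall (0:V3) 1) ∧
      ∀ x ∈ Metric.closedBall (0:V3) 1, ∀ i j,
        (∑ p, ∑ q, g (φ x) p q * pd i (fun y => φ y p) x * pd j (fun y => φ y q) x)
          = if i = j then (1:ℝ) else 0 := by
  obtain ⟨F, w, hF, hw, hFw⟩ := exists_isometric_immersion hgC hginvC hgsym hinv
    (hpos 0 (by simp)) hRic
  obtain ⟨Φ, hΦ, hΦS, hΦg⟩ := exists_isometric_immersion_mapsTo_sphere hNC hNunit
    (fun x hx v hv => cov_normal_eq hgC hNC hgsym hinv hpos hNunit hNtang hNout hΘ hx hv)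
    hF hw (fun x hx => (hFw x hx).1) (fun x hx => (hFw x hx).2.1) (fun x hx => (hFw x hx).2.2)
  obtain ⟨φ, hφ, hbij, hinvφ⟩ := exists_contDiff_inverse_on_closedBall hΦ
    (fun x hx => isInvertible_fderiv hΦ (hpos x hx) (hΦg x hx)) hΦS
  exact ⟨φ, hφ, hbij, fun x hx => sum_metric_mul_pd_eq hΦ hφ (hΦg _ (hbij.mapsTo hx)) (hinvφ x hx)⟩

end Stmt12
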